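/- arXiv:1802.05441 — 8 statements merged into one kernel-verified Lean document; each statement's English description precedes it below -/
import Mathlib

section
/- Let 0 < n < 1 and T > 0. Let s : ℝ → ℝ be continuously differentiable on [0, T] with s(0) = 0, and define ψ(a) = ∫_{x=0}^{a} s'(x)·(a − x)^{−n} dx for a ∈ (0, T]. Then for every x ∈ (0, T] one has s(x) = (sin(nπ)/π) · x^{n} · ∫_{t=0}^{1} ψ(x·t)·(1 − t)^{n−1} dt. (Abel's 'remarkable theorem' of 1823: inversion of the Abel integral equation.) -/
/-- The Beta integral `B(1 - n, n)` transported to the interval `(y, x)`. -/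
lemma integral_Ioo_sub_rpow_neg_mul_sub_rpow {n x y : ℝ} (hn0 : 0 < n) (hn1 : n < 1)
    (hyx : y < x) :
    ∫ a in Set.Ioo y x, (a - y) ^ (-n) * (x - a) ^ (n - 1) =
      Real.pi / Real.sin (n * Real.pi) := by
  have hc : 0 < x - y := sub_pos.2 hyx
  rw [← MeasureTheory.integral_Ioc_eq_integral_Ioo, ← intervalIntegral.integral_of_le hyx.le]
  have h1 : ∫ a in y..x, (a - y) ^ (-n) * (x - a) ^ (n - 1) =
      ∫ b in (0 : ℝ)..(x - y), b ^ (-n) * (x - y - b) ^ (n - 1) := by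
    have := intervalIntegral.integral_comp_sub_right (a := y) (b := x)
      (fun b : ℝ => b ^ (-n) * (x - y - b) ^ (n - 1)) y
    rw [sub_self] at this
    rw [← this]
    congr 1; ext a; congr 2; ring
  rw [h1]
  have h2 := Complex.betaIntegral_scaled (1 - n : ℂ) (n : ℂ) hc
  have h3 := Complex.Gamma_mul_Gamma_eq_betaIntegral (s := (1 - n : ℂ)) (t := (n : ℂ))
    (by simpa using hn1) (by simpa using hn0)
  rw [sub_add_cancel, Complex.Gamma_one, one_mul, mul_comm, Complex.Gamma_mul_Gamma_one_sub] at h3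
  rw [sub_add_cancel, sub_self, Complex.cpow_zero, one_mul, ← h3] at h2
  apply Complex.ofReal_injective
  rw [← intervalIntegral.integral_ofReal, mul_comm n]
  push_cast
  rw [← h2]
  apply intervalIntegral.integral_congr
  intro b hb
  rw [Set.uIcc_of_le hc.le] at hb
  simp only
  rw [Complex.ofReal_cpow hb.1, Complex.ofReal_cpow (sub_nonneg.2 hb.2)]
  push_cast
  congr 2
  ring

/-- The kernel obtained by composing the Abel transforms of orders `n` and `1 - n`, evaluated
at `x`. -/
noncomputable def abelKernel (n x : ℝ) (p : ℝ × ℝ) : ℝ :=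
  if p.1 < p.2 then (p.2 - p.1) ^ (-n) * (x - p.2) ^ (n - 1) else 0

lemma measurable_abelKernel (n x : ℝ) : Measurable (abelKernel n x) := by
  unfold abelKernel
  refine Measurable.ite (measurableSet_lt measurable_fst measurable_snd) ?_ measurable_const
  fun_prop

lemma abelKernel_mk_left (n x y : ℝ) :
    (fun a => abelKernel n x (y, a)) =
      (Set.Ioi y).indicator fun a => (a - y) ^ (-n) * (x - a) ^ (n - 1) := by
  ext a
  simp [abelKernel, Set.indicator_apply]

lemma integral_abelKernel {n x y : ℝ} (hn0 : 0 < n) (hn1 : n < 1) (hy : y ∈ Set.Ioo 0 x) :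
    ∫ a in Set.Ioo 0 x, abelKernel n x (y, a) = Real.pi / Real.sin (n * Real.pi) := by
  rw [abelKernel_mk_left, MeasureTheory.setIntegral_indicator measurableSet_Ioi,
    ← integral_Ioo_sub_rpow_neg_mul_sub_rpow hn0 hn1 hy.2]
  congr 2
  ext a
  simp only [Set.mem_inter_iff, Set.mem_Ioo, Set.mem_Ioi]
  exact ⟨fun h => ⟨h.2, h.1.2⟩, fun h => ⟨⟨hy.1.trans h.1, h.2⟩, h.1⟩⟩

lemma sin_mul_pi_pos {n : ℝ} (hn0 : 0 < n) (hn1 : n < 1) : 0 < Real.sin (n * Real.pi) :=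
  Real.sin_pos_of_pos_of_lt_pi (by positivity) (by nlinarith [Real.pi_pos])

lemma integrable_abelKernel {n x : ℝ} (hn0 : 0 < n) (hn1 : n < 1) :
    MeasureTheory.Integrable (abelKernel n x)
      ((MeasureTheory.volume.restrict (Set.Ioo 0 x)).prod
        (MeasureTheory.volume.restrict (Set.Ioo 0 x))) := by
  have hC : Real.pi / Real.sin (n * Real.pi) ≠ 0 :=
    (div_pos Real.pi_pos (sin_mul_pi_pos hn0 hn1)).ne'
  rw [MeasureTheory.integrable_prod_iff (measurable_abelKernel n x).aestronglyMeasurable]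
  constructor
  · filter_upwards [MeasureTheory.ae_restrict_mem measurableSet_Ioo] with y hy
    by_contra h
    exact hC (by rw [← integral_abelKernel hn0 hn1 hy, MeasureTheory.integral_undef h])
  · refine (MeasureTheory.integrable_const (Real.pi / Real.sin (n * Real.pi))).congr ?_
    filter_upwards [MeasureTheory.ae_restrict_mem measurableSet_Ioo] with y hy
    rw [← integral_abelKernel hn0 hn1 hy]
    refine MeasureTheory.setIntegral_congr_fun measurableSet_Ioo fun a ha => ?_
    refine (Real.norm_of_nonneg ?_).symm
    unfold abelKernel
    split_ifs with h
    · exact mul_nonneg (Real.rpow_nonneg (sub_nonneg.2 h.le) _)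
        (Real.rpow_nonneg (sub_nonneg.2 ha.2.le) _)
    · exact le_rfl

/-- Composing the Abel transform of order `n` with the one of order `1 - n` gives a multiple of
the integral. -/
lemma integral_abel_mul_sub_rpow {n x : ℝ} (hn0 : 0 < n) (hn1 : n < 1) {g : ℝ → ℝ}
    (hg : ContinuousOn g (Set.Icc 0 x)) :
    ∫ a in Set.Ioo 0 x, (∫ y in Set.Ioo 0 a, g y * (a - y) ^ (-n)) * (x - a) ^ (n - 1) =
      Real.pi / Real.sin (n * Real.pi) * ∫ y in Set.Ioo 0 x, g y := by
  obtain ⟨M, hM⟩ := isCompact_Icc.exists_bound_of_continuousOn hg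
  have hgm : MeasureTheory.AEStronglyMeasurable g (MeasureTheory.volume.restrict (Set.Ioo 0 x)) :=
    (hg.mono Set.Ioo_subset_Icc_self).aestronglyMeasurable measurableSet_Ioo
  have hint : MeasureTheory.Integrable (Function.uncurry fun y a => g y * abelKernel n x (y, a))
      ((MeasureTheory.volume.restrict (Set.Ioo 0 x)).prod
        (MeasureTheory.volume.restrict (Set.Ioo 0 x))) := by
    refine (integrable_abelKernel hn0 hn1).bdd_mul (c := M) hgm.comp_fst ?_
    refine MeasureTheory.Measure.quasiMeasurePreserving_fst.ae (p := fun y => ‖g y‖ ≤ M) ?_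
    filter_upwards [MeasureTheory.ae_restrict_mem measurableSet_Ioo] with y hy
    exact hM y (Set.Ioo_subset_Icc_self hy)
  have hswap := MeasureTheory.integral_integral_swap hint
  have hleft : ∫ y in Set.Ioo 0 x, ∫ a in Set.Ioo 0 x, g y * abelKernel n x (y, a) =
      Real.pi / Real.sin (n * Real.pi) * ∫ y in Set.Ioo 0 x, g y := by
    rw [← MeasureTheory.integral_const_mul]
    refine MeasureTheory.setIntegral_congr_fun measurableSet_Ioo fun y hy => ?_
    rw [MeasureTheory.integral_const_mul, integral_abelKernel hn0 hn1 hy, mul_comm]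
  rw [← hleft, hswap]
  refine MeasureTheory.setIntegral_congr_fun measurableSet_Ioo fun a ha => ?_
  rw [← MeasureTheory.integral_mul_const]
  have hind : (fun y => g y * abelKernel n x (y, a)) =
      (Set.Iio a).indicator fun y => g y * (a - y) ^ (-n) * (x - a) ^ (n - 1) := by
    ext y
    simp [abelKernel, Set.indicator_apply, mul_assoc]
  rw [hind, MeasureTheory.setIntegral_indicator measurableSet_Iio]
  congr 2
  ext y
  simp only [Set.mem_inter_iff, Set.mem_Ioo, Set.mem_Iio]
  exact ⟨fun h => ⟨⟨h.1, h.2.trans ha.2⟩, h.2⟩, fun h => ⟨h.1.1, h.2⟩⟩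

/-- Rescaling a weighted integral over `[0, 1]` to `[0, x]`. -/
lemma rpow_mul_integral_comp_mul_one_sub_rpow {n x : ℝ} (hx : 0 < x) (f : ℝ → ℝ) :
    x ^ n * ∫ t in (0 : ℝ)..1, f (x * t) * (1 - t) ^ (n - 1) =
      ∫ a in (0 : ℝ)..x, f a * (x - a) ^ (n - 1) := by
  have h := intervalIntegral.mul_integral_comp_mul_left (a := 0) (b := 1)
    (f := fun a => f a * (x - a) ^ (n - 1)) (c := x)
  rw [mul_zero, mul_one] at h
  rw [← h, ← intervalIntegral.integral_const_mul, ← intervalIntegral.integral_const_mul]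
  refine intervalIntegral.integral_congr fun t ht => ?_
  rw [Set.uIcc_of_le zero_le_one] at ht
  rw [show x - x * t = x * (1 - t) by ring, Real.mul_rpow hx.le (sub_nonneg.2 ht.2),
    Real.rpow_sub_one hx.ne']
  field_simp

/-- Abel's "remarkable theorem" of 1823: inversion of the Abel integral equation.
If ψ(a) = ∫_{0}^{a} s'(x)·(a − x)^{−n} dx for a ∈ (0, T], then
s(x) = (sin(nπ)/π) · xⁿ · ∫_{0}^{1} ψ(x·t)·(1 − t)^{n−1} dt for x ∈ (0, T]. -/
theorem abel_remarkable_theorem_1823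
    (n T : ℝ) (hn0 : 0 < n) (hn1 : n < 1) (hT : 0 < T)
    (s s' : ℝ → ℝ)
    (hderiv : ∀ x ∈ Set.Icc (0 : ℝ) T, HasDerivAt s (s' x) x)
    (hcont : ContinuousOn s' (Set.Icc (0 : ℝ) T))
    (hs0 : s 0 = 0)
    (ψ : ℝ → ℝ)
    (hψ : ∀ a ∈ Set.Ioc (0 : ℝ) T, ψ a = ∫ x in (0 : ℝ)..a, s' x * (a - x) ^ (-n)) :
    ∀ x ∈ Set.Ioc (0 : ℝ) T,
      s x = (Real.sin (n * Real.pi) / Real.pi) * x ^ n *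
        ∫ t in (0 : ℝ)..1, ψ (x * t) * (1 - t) ^ (n - 1) := by
  intro x hx
  have hsub : Set.Icc 0 x ⊆ Set.Icc 0 T := Set.Icc_subset_Icc_right hx.2
  have hc : ContinuousOn s' (Set.Icc 0 x) := hcont.mono hsub
  have hftc : ∫ y in (0 : ℝ)..x, s' y = s x := by
    rw [intervalIntegral.integral_eq_sub_of_hasDerivAt (f := s), hs0, sub_zero]
    · intro y hy
      rw [Set.uIcc_of_le hx.1.le] at hy
      exact hderiv y (hsub hy)
    · exact hc.intervalIntegrable_of_Icc hx.1.le
  rw [mul_assoc, rpow_mul_integral_comp_mul_one_sub_rpow hx.1,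
    intervalIntegral.integral_of_le hx.1.le, MeasureTheory.integral_Ioc_eq_integral_Ioo]
  have hcongr : ∫ a in Set.Ioo 0 x, ψ a * (x - a) ^ (n - 1) =
      ∫ a in Set.Ioo 0 x, (∫ y in Set.Ioo 0 a, s' y * (a - y) ^ (-n)) * (x - a) ^ (n - 1) := by
    refine MeasureTheory.setIntegral_congr_fun measurableSet_Ioo fun a ha => ?_
    rw [hψ a ⟨ha.1, ha.2.le.trans hx.2⟩, intervalIntegral.integral_of_le ha.1.le,
      MeasureTheory.integral_Ioc_eq_integral_Ioo]
  rw [hcongr, integral_abel_mul_sub_rpow hn0 hn1 hc, ← MeasureTheory.integral_Ioc_eq_integral_Ioo,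
    ← intervalIntegral.integral_of_le hx.1.le, hftc]
  have := (sin_mul_pi_pos hn0 hn1).ne'
  have := Real.pi_pos.ne'
  field_simp
end

section
/- Let 0 < n < 1 and T > 0. Let s : ℝ → ℝ be continuously differentiable on [0, T] with s(0) = 0, and define ψ(a) = ∫_{x=0}^{a} s'(x)·(a − x)^{−n} dx for a ∈ (0, T]. Then for every x ∈ (0, T] one has s(x) = (sin(nπ)/π) · ∫_{a=0}^{x} ψ(a)·(x − a)^{n−1} da. (Abel's 1826 form of the solution: the fractional integral of order n of ψ, up to the factor 1/(Γ(n)Γ(1−n)) = sin(nπ)/π.) -/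
open MeasureTheory Set in
theorem integral_sub_rpow_neg_mul_sub_rpow_sub_one {n y X : ℝ} (hn0 : 0 < n) (hn1 : n < 1)
    (hyX : y < X) :
    ∫ a in y..X, (a - y) ^ (-n) * (X - a) ^ (n - 1) = Real.pi / Real.sin (n * Real.pi) := by
  have hshift : ∫ a in y..X, (a - y) ^ (-n) * (X - a) ^ (n - 1)
      = ∫ t in (0 : ℝ)..(X - y), t ^ (-n) * ((X - y) - t) ^ (n - 1) := by
    have := intervalIntegral.integral_comp_sub_right (a := y) (b := X)
      (fun t : ℝ => t ^ (-n) * ((X - y) - t) ^ (n - 1)) y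
    simpa using this
  have hpos : 0 < X - y := sub_pos.2 hyX
  rw [hshift]
  apply Complex.ofReal_injective
  rw [← intervalIntegral.integral_ofReal]
  have hbeta := Complex.betaIntegral_scaled (1 - n : ℂ) n hpos
  have hGamma := Complex.Gamma_mul_Gamma_eq_betaIntegral (s := (1 - n : ℂ)) (t := n)
    (by simpa using hn1) (by simpa using hn0)
  rw [mul_comm, Complex.Gamma_mul_Gamma_one_sub] at hGamma
  simp only [sub_add_cancel, Complex.Gamma_one, one_mul, sub_self, Complex.cpow_zero] at hbeta hGamma
  rw [← hGamma] at hbeta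
  push_cast
  rw [mul_comm (n : ℂ), ← hbeta]
  refine intervalIntegral.integral_congr fun t ht => ?_
  rw [uIcc_of_le hpos.le] at ht
  rw [Complex.ofReal_cpow ht.1, Complex.ofReal_cpow (sub_nonneg.2 ht.2)]
  push_cast
  congr 2
  ring

open MeasureTheory Set in
theorem integrableOn_sub_rpow_neg_mul_sub_rpow_sub_one {n y X : ℝ} (hn0 : 0 < n) (hn1 : n < 1)
    (hyX : y < X) :
    IntegrableOn (fun a => (a - y) ^ (-n) * (X - a) ^ (n - 1)) (Ioc y X) := by
  refine Integrable.of_integral_ne_zero ?_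
  rw [← intervalIntegral.integral_of_le hyX.le,
    integral_sub_rpow_neg_mul_sub_rpow_sub_one hn0 hn1 hyX]
  refine (div_pos Real.pi_pos (Real.sin_pos_of_pos_of_lt_pi (by positivity) ?_)).ne'
  nlinarith [Real.pi_pos]

open MeasureTheory Set in
theorem integral_abel_transform_mul_rpow {n X : ℝ} (hn0 : 0 < n) (hn1 : n < 1) (hX : 0 < X)
    {g : ℝ → ℝ} (hg : Continuous g) :
    ∫ a in (0 : ℝ)..X, (∫ y in (0 : ℝ)..a, g y * (a - y) ^ (-n)) * (X - a) ^ (n - 1)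
      = Real.pi / Real.sin (n * Real.pi) * ∫ y in (0 : ℝ)..X, g y := by
  set C := Real.pi / Real.sin (n * Real.pi) with hC
  set k : ℝ → ℝ → ℝ := fun a y => (a - y) ^ (-n) * (X - a) ^ (n - 1) with hk
  set F : ℝ → ℝ → ℝ := fun a y => (Ioi y).indicator (fun a => g y * k a y) a with hF
  set μ : Measure ℝ := volume.restrict (Ioc 0 X) with hμ
  have hrestrict : ∀ y ∈ Ioc (0 : ℝ) X, μ.restrict (Ioi y) = volume.restrict (Ioc y X) := by
    intro y hy
    rw [hμ, Measure.restrict_restrict measurableSet_Ioi]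
    congr 1
    ext a
    simp only [mem_inter_iff, mem_Ioi, mem_Ioc]
    exact ⟨fun h => ⟨h.1, h.2.2⟩, fun h => ⟨h.1, hy.1.trans h.1, h.2⟩⟩
  have hk_int : ∀ y ∈ Ioc (0 : ℝ) X, IntegrableOn (fun a => k a y) (Ioc y X) := by
    intro y hy
    rcases hy.2.lt_or_eq with h | h
    · exact integrableOn_sub_rpow_neg_mul_sub_rpow_sub_one hn0 hn1 h
    · simp [h]
  have hk_val : ∀ y, y < X → ∫ a in Ioc y X, k a y = C := by
    intro y h
    rw [← intervalIntegral.integral_of_le h.le]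
    exact integral_sub_rpow_neg_mul_sub_rpow_sub_one hn0 hn1 h
  have hlt : ∀ᵐ y ∂μ, y ∈ Ioc (0 : ℝ) X ∧ y < X := by
    have hne : ∀ᵐ y ∂μ, y ≠ X := ae_restrict_of_ae (Measure.ae_ne volume X)
    filter_upwards [hne, ae_restrict_mem measurableSet_Ioc] with y h1 h2
    exact ⟨h2, h2.2.lt_of_ne h1⟩
  have hmeas : Measurable (Function.uncurry F) := by
    have : Function.uncurry F = {p : ℝ × ℝ | p.2 < p.1}.indicator
        (fun p => g p.2 * ((p.1 - p.2) ^ (-n) * (X - p.1) ^ (n - 1))) := by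
      ext ⟨a, y⟩
      simp [hF, hk, indicator]
    rw [this]
    refine Measurable.indicator ?_ (measurableSet_lt measurable_snd measurable_fst)
    have := hg.measurable
    fun_prop
  have hgμ : Integrable g μ := (hg.integrableOn_Icc (a := 0) (b := X)).mono_set Ioc_subset_Icc_self
  have hint : Integrable (Function.uncurry F) (μ.prod μ) := by
    rw [integrable_prod_iff' hmeas.aestronglyMeasurable]
    constructor
    · filter_upwards [hlt] with y hy
      simp only [Function.uncurry, hF]
      rw [integrable_indicator_iff measurableSet_Ioi, IntegrableOn, hrestrict y hy.1]
      exact (hk_int y hy.1).const_mul _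
    · refine (hgμ.norm.mul_const C).congr ?_
      filter_upwards [hlt] with y hy
      simp only [Function.uncurry, hF, norm_indicator_eq_indicator_norm]
      rw [integral_indicator measurableSet_Ioi, hrestrict y hy.1, ← hk_val y hy.2,
        ← integral_const_mul]
      refine setIntegral_congr_fun measurableSet_Ioc fun a ha => ?_
      simp only [norm_mul (g y)]
      rw [Real.norm_of_nonneg (r := k a y)]
      exact mul_nonneg (Real.rpow_nonneg (sub_nonneg.2 ha.1.le) _)
        (Real.rpow_nonneg (sub_nonneg.2 ha.2) _)
  have hswap := integral_integral_swap hint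
  have hleft : ∫ a, ∫ y, F a y ∂μ ∂μ =
      ∫ a in (0 : ℝ)..X, (∫ y in (0 : ℝ)..a, g y * (a - y) ^ (-n)) * (X - a) ^ (n - 1) := by
    rw [intervalIntegral.integral_of_le hX.le]
    refine setIntegral_congr_fun measurableSet_Ioc fun a ha => ?_
    have hFa : F a = (Iio a).indicator (fun y => g y * k a y) := by
      ext y
      simp [hF, indicator]
    have hset : Iio a ∩ Ioc 0 X = Ioo 0 a := by
      ext y
      simp only [mem_inter_iff, mem_Iio, mem_Ioc, mem_Ioo]
      exact ⟨fun h => ⟨h.2.1, h.1⟩, fun h => ⟨h.2, h.1, h.2.le.trans ha.2⟩⟩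
    simp only [hFa]
    rw [integral_indicator measurableSet_Iio, hμ, Measure.restrict_restrict measurableSet_Iio,
      hset, intervalIntegral.integral_of_le ha.1.le, integral_Ioc_eq_integral_Ioo,
      ← integral_mul_const]
    simp only [hk, mul_assoc]
  have hright : ∫ y, ∫ a, F a y ∂μ ∂μ = C * ∫ y in (0 : ℝ)..X, g y := by
    rw [intervalIntegral.integral_of_le hX.le, ← integral_const_mul]
    refine integral_congr_ae ?_
    filter_upwards [hlt] with y hy
    simp only [hF]
    rw [integral_indicator measurableSet_Ioi, hrestrict y hy.1, integral_const_mul,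
      hk_val y hy.2, mul_comm]
  rw [← hleft, hswap, hright]

/-- Abel's 1826 form of the solution of the Abel integral equation:
if ψ(a) = ∫_{0}^{a} s'(x)·(a − x)^{−n} dx for a ∈ (0, T], then
s(x) = (sin(nπ)/π) · ∫_{0}^{x} ψ(a)·(x − a)^{n−1} da for x ∈ (0, T]. -/
theorem abel_solution_1826
    (n T : ℝ) (hn0 : 0 < n) (hn1 : n < 1) (hT : 0 < T)
    (s s' : ℝ → ℝ)
    (hderiv : ∀ x ∈ Set.Icc (0 : ℝ) T, HasDerivAt s (s' x) x)
    (hcont : ContinuousOn s' (Set.Icc (0 : ℝ) T))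
    (hs0 : s 0 = 0)
    (ψ : ℝ → ℝ)
    (hψ : ∀ a ∈ Set.Ioc (0 : ℝ) T, ψ a = ∫ x in (0 : ℝ)..a, s' x * (a - x) ^ (-n)) :
    ∀ x ∈ Set.Ioc (0 : ℝ) T,
      s x = (Real.sin (n * Real.pi) / Real.pi) *
        ∫ a in (0 : ℝ)..x, ψ a * (x - a) ^ (n - 1) := by
  intro X hX
  have hsub : Set.Icc 0 X ⊆ Set.Icc 0 T := Set.Icc_subset_Icc_right hX.2
  set g : ℝ → ℝ := Set.IccExtend hT.le ((Set.Icc 0 T).domRestrict s') with hg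
  have hgc : Continuous g := hcont.domRestrict.Icc_extend'
  have hgs : ∀ y ∈ Set.Icc (0 : ℝ) T, g y = s' y := fun y hy =>
    Set.IccExtend_of_mem hT.le _ hy
  have hftc : ∫ y in (0 : ℝ)..X, g y = s X := by
    rw [intervalIntegral.integral_eq_sub_of_hasDerivAt (f := s) _ (hgc.intervalIntegrable 0 X),
      hs0, sub_zero]
    intro y hy
    rw [Set.uIcc_of_le hX.1.le] at hy
    rw [hgs y (hsub hy)]
    exact hderiv y (hsub hy)
  have hψg : ∫ a in (0 : ℝ)..X, ψ a * (X - a) ^ (n - 1) =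
      ∫ a in (0 : ℝ)..X, (∫ y in (0 : ℝ)..a, g y * (a - y) ^ (-n)) * (X - a) ^ (n - 1) := by
    rw [intervalIntegral.integral_of_le hX.1.le, intervalIntegral.integral_of_le hX.1.le]
    refine MeasureTheory.setIntegral_congr_fun measurableSet_Ioc fun a ha => ?_
    have haT : a ∈ Set.Ioc 0 T := ⟨ha.1, ha.2.trans hX.2⟩
    simp only [hψ a haT]
    congr 1
    refine intervalIntegral.integral_congr fun y hy => ?_
    rw [Set.uIcc_of_le ha.1.le] at hy
    simp only [hgs y ⟨hy.1, hy.2.trans haT.2⟩]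
  have hsin : 0 < Real.sin (n * Real.pi) :=
    Real.sin_pos_of_pos_of_lt_pi (by positivity) (by nlinarith [Real.pi_pos])
  rw [hψg, integral_abel_transform_mul_rpow hn0 hn1 hX.1 hgc, hftc]
  field_simp
end

section
/- Let 0 < n < 1, x₀ > 0, and let g : ℝ → ℝ be continuous on [0, x₀]. Then for every x ∈ [0, x₀], ∫_{a=0}^{x} (x − a)^{n−1} · ( ∫_{z=0}^{a} g(z)·(a − z)^{−n} dz ) da = Γ(n)·Γ(1 − n) · ∫_{z=0}^{x} g(z) dz, where Γ is the real Gamma function. (The composition identity underlying equation (1) of Abel's 1826 paper: the fractional integrals of orders n and 1 − n compose to an ordinary integral.) -/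
open MeasureTheory Set in
/-- The beta integral over an arbitrary interval, for exponents summing to `-1`. -/
theorem integral_rpow_mul_rpow_eq_Gamma_mul_Gamma {n z x : ℝ} (hn0 : 0 < n) (hn1 : n < 1)
    (hzx : z < x) :
    ∫ a in z..x, (x - a) ^ (n - 1) * (a - z) ^ (-n) = Real.Gamma n * Real.Gamma (1 - n) := by
  have hpos : 0 < x - z := sub_pos.2 hzx
  have hscaled := Complex.betaIntegral_scaled ((1 - n : ℝ) : ℂ) (n : ℂ) hpos
  have hGamma := Complex.Gamma_mul_Gamma_eq_betaIntegral (s := ((1 - n : ℝ) : ℂ)) (t := (n : ℂ))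
    (by simpa using hn1) (by simpa using hn0)
  have hsum : ((1 - n : ℝ) : ℂ) + n = 1 := by push_cast; ring
  rw [hsum, Complex.Gamma_one, one_mul] at hGamma
  rw [hsum, sub_self, Complex.cpow_zero, one_mul, ← hGamma, Complex.Gamma_ofReal,
    Complex.Gamma_ofReal] at hscaled
  have hshift : ∫ a in z..x, (x - a) ^ (n - 1) * (a - z) ^ (-n)
      = ∫ t in (0 : ℝ)..(x - z), t ^ (-n) * (x - z - t) ^ (n - 1) := by
    have h := intervalIntegral.integral_comp_sub_right (a := z) (b := x)
      (fun t : ℝ => t ^ (-n) * (x - z - t) ^ (n - 1)) z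
    rw [sub_self] at h
    rw [← h]
    congr 1 with a
    rw [mul_comm, show x - z - (a - z) = x - a by ring]
  rw [hshift, ← Complex.ofReal_inj, ← intervalIntegral.integral_ofReal, mul_comm,
    Complex.ofReal_mul, ← hscaled]
  refine intervalIntegral.integral_congr fun t ht => ?_
  rw [uIcc_of_le hpos.le] at ht
  have h2 : 0 ≤ x - z - t := sub_nonneg.2 ht.2
  simp only [Complex.ofReal_mul]
  rw [Complex.ofReal_cpow ht.1, Complex.ofReal_cpow h2]
  push_cast
  ring_nf

open MeasureTheory Set in
/-- A real power with exponent greater than `-1`, cut off to a bounded interval, is integrable. -/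
theorem integrable_indicator_Ioc_rpow {r : ℝ} (hr : -1 < r) {x : ℝ} (hx : 0 ≤ x) :
    Integrable ((Ioc 0 x).indicator fun t : ℝ => t ^ r) :=
  (integrable_indicator_iff measurableSet_Ioc).2 <|
    (intervalIntegrable_iff_integrableOn_Ioc_of_le hx).1
      (intervalIntegral.intervalIntegrable_rpow' hr)

open MeasureTheory Set in
/-- The composition identity underlying equation (1) of Abel's 1826 paper:
the fractional integrals of orders n and 1 − n compose to an ordinary integral. -/
theorem abel_composition_identity
    (n x₀ : ℝ) (hn0 : 0 < n) (hn1 : n < 1) (hx₀ : 0 < x₀)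
    (g : ℝ → ℝ) (hg : ContinuousOn g (Set.Icc (0 : ℝ) x₀)) :
    ∀ x ∈ Set.Icc (0 : ℝ) x₀,
      (∫ a in (0 : ℝ)..x, (x - a) ^ (n - 1) * ∫ z in (0 : ℝ)..a, g z * (a - z) ^ (-n))
        = Real.Gamma n * Real.Gamma (1 - n) * ∫ z in (0 : ℝ)..x, g z := by
  intro x hx
  have hgx : ContinuousOn g (Icc 0 x) := hg.mono (Icc_subset_Icc_right hx.2)
  set P : ℝ → ℝ := (Ioc 0 x).indicator fun t => t ^ (n - 1) with hP
  set Q : ℝ → ℝ := (Ioc 0 x).indicator fun t => t ^ (-n) with hQ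
  set G : ℝ → ℝ := (Ioc 0 x).indicator g with hG
  have hPi : Integrable P := integrable_indicator_Ioc_rpow (by linarith) hx.1
  have hQi : Integrable Q := integrable_indicator_Ioc_rpow (by linarith) hx.1
  have hGi : Integrable G := (integrable_indicator_iff measurableSet_Ioc).2
    (hgx.integrableOn_Icc.mono_set Ioc_subset_Icc_self)
  obtain ⟨C, hC⟩ := isCompact_Icc.exists_bound_of_continuousOn hgx
  have hGC : ∀ z, ‖G z‖ ≤ max C 0 := fun z => by
    by_cases hz : z ∈ Ioc 0 x
    · rw [hG, indicator_of_mem hz]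
      exact (hC z (Ioc_subset_Icc_self hz)).trans (le_max_left _ _)
    · rw [hG, indicator_of_notMem hz]
      simp
  have hK : Integrable (fun p : ℝ × ℝ => G p.1 * (P (x - p.2) * Q (p.2 - p.1)))
      (volume.prod volume) := by
    have h := (hPi.comp_sub_left x).convolution_integrand (ContinuousLinearMap.mul ℝ ℝ) hQi.comp_neg
    simp only [ContinuousLinearMap.mul_apply', neg_sub] at h
    exact h.bdd_mul (c := max C 0) hGi.aestronglyMeasurable.comp_fst (.of_forall fun p => hGC p.1)
  have hswap := integral_integral_swap (f := fun z a => G z * (P (x - a) * Q (a - z))) hK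
  have hleft : ∀ a, ∫ z, G z * (P (x - a) * Q (a - z)) = (Ioc 0 x).indicator
      (fun a => (x - a) ^ (n - 1) * ∫ z in (0 : ℝ)..a, g z * (a - z) ^ (-n)) a := by
    intro a
    by_cases ha : a ∈ Ioc 0 x
    · rw [indicator_of_mem ha, intervalIntegral.integral_of_le ha.1.le,
        ← integral_indicator measurableSet_Ioc, ← integral_const_mul]
      congr 1 with z
      have hPa : P (x - a) = (x - a) ^ (n - 1) := by
        rcases ha.2.eq_or_lt with rfl | h
        · rw [sub_self, Real.zero_rpow (by linarith)]
          simp [hP]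
        · exact indicator_of_mem (s := Ioc 0 x) ⟨sub_pos.2 h, by linarith [ha.1]⟩ _
      rw [hPa]
      by_cases hz : z ∈ Ioc 0 a
      · have hQz : Q (a - z) = (a - z) ^ (-n) := by
          rcases hz.2.eq_or_lt with rfl | h
          · rw [sub_self, Real.zero_rpow (by linarith)]
            simp [hQ]
          · exact indicator_of_mem (s := Ioc 0 x) ⟨sub_pos.2 h, by linarith [hz.1, ha.2]⟩ _
        rw [indicator_of_mem hz, hQz, hG, indicator_of_mem (s := Ioc 0 x) ⟨hz.1, hz.2.trans ha.2⟩]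
        ring
      · rw [indicator_of_notMem hz, mul_zero]
        by_cases hz0 : 0 < z
        · have : a < z := by by_contra! h; exact hz ⟨hz0, h⟩
          rw [hQ, indicator_of_notMem fun h => by linarith [h.1]]
          simp
        · rw [hG, indicator_of_notMem fun h => hz0 h.1, zero_mul]
    · rw [indicator_of_notMem ha]
      refine integral_eq_zero_of_ae (.of_forall fun z => ?_)
      by_contra hne
      have h1 : z ∈ Ioc 0 x := by
        by_contra h; exact hne (by simp [hG, indicator_of_notMem h])
      have h2 : x - a ∈ Ioc 0 x := by
        by_contra h; exact hne (by simp [hP, indicator_of_notMem h])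
      have h3 : a - z ∈ Ioc 0 x := by
        by_contra h; exact hne (by simp [hQ, indicator_of_notMem h])
      exact ha ⟨by linarith [h1.1, h3.1], by linarith [h2.1]⟩
  have hright : ∀ᵐ z, ∫ a, G z * (P (x - a) * Q (a - z))
      = (Real.Gamma n * Real.Gamma (1 - n)) * G z := by
    filter_upwards [compl_mem_ae_iff.2 (measure_singleton x)] with z hzx
    rw [integral_const_mul, mul_comm]
    by_cases hz : z ∈ Ioc 0 x
    · have hlt : z < x := lt_of_le_of_ne hz.2 hzx
      congr 1
      rw [← integral_rpow_mul_rpow_eq_Gamma_mul_Gamma hn0 hn1 hlt,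
        intervalIntegral.integral_of_le hlt.le,
        integral_Ioc_eq_integral_Ioo, ← integral_indicator measurableSet_Ioo]
      congr 1 with a
      by_cases ha : a ∈ Ioo z x
      · rw [indicator_of_mem ha, hP, hQ,
          indicator_of_mem (s := Ioc 0 x) ⟨sub_pos.2 ha.2, by linarith [ha.1, hz.1]⟩,
          indicator_of_mem (s := Ioc 0 x) ⟨sub_pos.2 ha.1, by linarith [ha.2, hz.1]⟩]
      · rw [indicator_of_notMem ha]
        by_contra hne
        have h2 : x - a ∈ Ioc 0 x := by
          by_contra h; exact hne (by simp [hP, indicator_of_notMem h])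
        have h3 : a - z ∈ Ioc 0 x := by
          by_contra h; exact hne (by simp [hQ, indicator_of_notMem h])
        exact ha ⟨by linarith [h3.1], by linarith [h2.1]⟩
    · rw [hG, indicator_of_notMem hz, mul_zero, mul_zero]
  rw [integral_congr_ae hright, integral_const_mul, hG, integral_indicator measurableSet_Ioc] at hswap
  simp only [← hG, hleft] at hswap
  rw [integral_indicator measurableSet_Ioc] at hswap
  rw [intervalIntegral.integral_of_le hx.1, intervalIntegral.integral_of_le hx.1, hswap]
end

section
/- Let 0 < n < 1 and T > 0. Let ψ : ℝ → ℝ be continuously differentiable on [0, T], and define s(x) = (1/Γ(n)) · ∫_{a=0}^{x} ψ(a)·(x − a)^{n−1} da for x ∈ [0, T], where Γ is the real Gamma function. Then s is differentiable on (0, T), and for every x ∈ (0, T], (1/Γ(1 − n)) · ∫_{a=0}^{x} s'(a)·(x − a)^{−n} da = ψ(x). (Abel's inversion: the fractional derivative of order n of the fractional integral of order n of ψ is ψ; in Abel's notation, ψ(x) = √π · d^{1/2}s/dx^{1/2} when n = 1/2.) -/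
open MeasureTheory Set ProbabilityTheory

/-- The power `t ^ (α - 1)`, truncated to be zero for `t ≤ 0`. -/
noncomputable def truncPow (α t : ℝ) : ℝ := (Ioi (0 : ℝ)).indicator (fun t => t ^ (α - 1)) t

/-- The Riemann–Liouville fractional integral of order `α` based at `0`. -/
noncomputable def fracIntegral (α : ℝ) (f : ℝ → ℝ) (x : ℝ) : ℝ :=
  (1 / Real.Gamma α) * ∫ a in (0 : ℝ)..x, f a * (x - a) ^ (α - 1)

lemma truncPow_of_pos {α t : ℝ} (ht : 0 < t) : truncPow α t = t ^ (α - 1) :=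
  indicator_of_mem (mem_Ioi.2 ht) _

lemma truncPow_of_nonpos {α t : ℝ} (ht : t ≤ 0) : truncPow α t = 0 :=
  indicator_of_notMem (notMem_Ioi.2 ht) _

lemma truncPow_nonneg (α t : ℝ) : 0 ≤ truncPow α t :=
  indicator_nonneg (fun _ ht => Real.rpow_nonneg (mem_Ioi.1 ht).le _) _

lemma measurable_truncPow (α : ℝ) : Measurable (truncPow α) :=
  (measurable_id.pow_const (α - 1)).indicator measurableSet_Ioi

lemma integral_rpow_mul_sub_rpow {α β x : ℝ} (hα : 0 < α) (hβ : 0 < β) (hx : 0 < x) :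
    ∫ u in (0 : ℝ)..x, u ^ (α - 1) * (x - u) ^ (β - 1) = x ^ (α + β - 1) * beta α β := by
  have h := Complex.betaIntegral_scaled α β hx
  have hB : Complex.betaIntegral α β = (beta α β : ℝ) := by
    rw [Complex.betaIntegral_eq_Gamma_mul_div _ _ (by simpa) (by simpa), beta,
      ← Complex.ofReal_add]
    simp_rw [Complex.Gamma_ofReal]
    norm_cast
  have hL : ∫ u in (0 : ℝ)..x, (u : ℂ) ^ ((α : ℂ) - 1) * ((x : ℂ) - u) ^ ((β : ℂ) - 1) =
      ∫ u in (0 : ℝ)..x, ((u ^ (α - 1) * (x - u) ^ (β - 1) : ℝ) : ℂ) := by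
    refine intervalIntegral.integral_congr fun u hu => ?_
    rw [uIcc_of_le hx.le] at hu
    simp only [Complex.ofReal_mul]
    rw [Complex.ofReal_cpow hu.1, Complex.ofReal_cpow (sub_nonneg.2 hu.2)]
    push_cast
    rfl
  rw [hL, intervalIntegral.integral_ofReal, hB] at h
  have hR : (x : ℂ) ^ ((α : ℂ) + β - 1) = ((x ^ (α + β - 1) : ℝ) : ℂ) := by
    rw [Complex.ofReal_cpow hx.le]
    push_cast
    rfl
  rw [hR] at h
  exact_mod_cast h

lemma intervalIntegrable_rpow_mul_sub_rpow {α β x : ℝ} (hα : 0 < α) (hβ : 0 < β) (hx : 0 < x) :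
    IntervalIntegrable (fun u => u ^ (α - 1) * (x - u) ^ (β - 1)) volume 0 x := by
  refine intervalIntegral.intervalIntegrable_of_integral_ne_zero ?_
  rw [integral_rpow_mul_sub_rpow hα hβ hx]
  exact (mul_pos (Real.rpow_pos_of_pos hx _) (beta_pos hα hβ)).ne'

lemma intervalIntegrable_sub_rpow {α : ℝ} (hα : 0 < α) (x : ℝ) :
    IntervalIntegrable (fun a => (x - a) ^ (α - 1)) volume 0 x := by
  have h : IntervalIntegrable (fun a : ℝ => a ^ (α - 1)) volume x 0 :=
    intervalIntegral.intervalIntegrable_rpow' (by linarith)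
  simpa using h.comp_sub_left x

/-- The real-line convolution identity for truncated powers, with its integrability. -/
lemma integrable_truncPow_mul_truncPow {α β : ℝ} (hα : 0 < α) (hβ : 0 < β) (a x : ℝ) :
    Integrable (fun u => truncPow α (u - a) * truncPow β (x - u)) ∧
    ∫ u, truncPow α (u - a) * truncPow β (x - u) = truncPow (α + β) (x - a) * beta α β := by
  rcases le_or_gt x a with hxa | hax
  · have h0 : (fun u => truncPow α (u - a) * truncPow β (x - u)) = fun _ => 0 := by
      funext u
      rcases le_or_gt u a with h | h
      · rw [truncPow_of_nonpos (by linarith), zero_mul]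
      · rw [truncPow_of_nonpos (α := β) (by linarith), mul_zero]
    rw [h0, truncPow_of_nonpos (by linarith)]
    simp
  · have hpos : 0 < x - a := sub_pos.2 hax
    have heq : (fun u => truncPow α (u - a) * truncPow β (x - u)) =
        (Ioo a x).indicator (fun u => (u - a) ^ (α - 1) * (x - u) ^ (β - 1)) := by
      funext u
      by_cases hu : u ∈ Ioo a x
      · rw [indicator_of_mem hu, truncPow_of_pos (sub_pos.2 hu.1), truncPow_of_pos (sub_pos.2 hu.2)]
      · rw [indicator_of_notMem hu]
        rcases le_or_gt u a with h | h
        · rw [truncPow_of_nonpos (by linarith), zero_mul]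
        · have : x ≤ u := not_lt.1 fun h' => hu ⟨h, h'⟩
          rw [truncPow_of_nonpos (α := β) (by linarith), mul_zero]
    constructor
    · rw [heq, integrable_indicator_iff measurableSet_Ioo,
        ← intervalIntegrable_iff_integrableOn_Ioo_of_le hax.le]
      have h := (intervalIntegrable_rpow_mul_sub_rpow hα hβ hpos).comp_sub_right a
      simpa using h
    · rw [heq, integral_indicator measurableSet_Ioo, ← integral_Ioc_eq_integral_Ioo,
        ← intervalIntegral.integral_of_le hax.le, truncPow_of_pos hpos,
        ← integral_rpow_mul_sub_rpow hα hβ hpos]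
      have h := intervalIntegral.integral_comp_sub_right (a := a) (b := x)
        (fun u => u ^ (α - 1) * (x - a - u) ^ (β - 1)) a
      rw [sub_self] at h
      rw [← h]
      simp

lemma setIntegral_truncPow (α : ℝ) (f : ℝ → ℝ) {x : ℝ} (hx : 0 ≤ x) :
    ∫ a in Ioi (0 : ℝ), f a * truncPow α (x - a) = ∫ a in (0 : ℝ)..x, f a * (x - a) ^ (α - 1) := by
  rw [intervalIntegral.integral_of_le hx, integral_Ioc_eq_integral_Ioo,
    setIntegral_eq_of_subset_of_forall_sdiff_eq_zero measurableSet_Ioi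
      (Ioo_subset_Ioi_self : Ioo 0 x ⊆ Ioi 0)]
  · exact setIntegral_congr_fun measurableSet_Ioo fun a ha => by
      simp only [truncPow_of_pos (sub_pos.2 ha.2)]
  · rintro a ⟨h, h'⟩
    have : x ≤ a := not_lt.1 fun h'' => h' ⟨h, h''⟩
    rw [truncPow_of_nonpos (by linarith), mul_zero]

lemma integrableOn_mul_truncPow {α : ℝ} (hα : 0 < α) {f : ℝ → ℝ} (hf : Continuous f) {x : ℝ}
    (hx : 0 ≤ x) : IntegrableOn (fun a => f a * truncPow α (x - a)) (Ioi 0) := by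
  have h := ((intervalIntegrable_sub_rpow hα x).continuousOn_mul hf.continuousOn)
  rw [intervalIntegrable_iff_integrableOn_Ioo_of_le hx] at h
  refine IntegrableOn.of_forall_sdiff_eq_zero (s := Ioo 0 x) ?_ measurableSet_Ioi ?_
  · exact h.congr_fun (fun a ha => by simp only [truncPow_of_pos (sub_pos.2 ha.2)])
      measurableSet_Ioo
  · rintro a ⟨h, h'⟩
    have : x ≤ a := not_lt.1 fun h'' => h' ⟨h, h''⟩
    rw [truncPow_of_nonpos (by linarith), mul_zero]

/-- Semigroup property of the Riemann–Liouville fractional integrals. -/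
theorem fracIntegral_fracIntegral {α β : ℝ} (hα : 0 < α) (hβ : 0 < β) {g : ℝ → ℝ}
    (hg : Continuous g) {x : ℝ} (hx : 0 ≤ x) :
    fracIntegral β (fracIntegral α g) x = fracIntegral (α + β) g x := by
  have hu : ∀ a ∈ Ioi (0 : ℝ),
      IntegrableOn (fun u => truncPow α (u - a) * truncPow β (x - u)) (Ioi 0) ∧
      ∫ u in Ioi 0, truncPow α (u - a) * truncPow β (x - u) =
        truncPow (α + β) (x - a) * beta α β := by
    intro a ha
    obtain ⟨h1, h2⟩ := integrable_truncPow_mul_truncPow hα hβ a x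
    refine ⟨h1.integrableOn, ?_⟩
    rw [← h2]
    refine setIntegral_eq_integral_of_forall_compl_eq_zero fun u hu => ?_
    rw [truncPow_of_nonpos (by linarith [notMem_Ioi.1 hu, mem_Ioi.1 ha]), zero_mul]
  have hF : Integrable
      (Function.uncurry fun u a => g a * (truncPow α (u - a) * truncPow β (x - u)))
      ((volume.restrict (Ioi 0)).prod (volume.restrict (Ioi 0))) := by
    have hm : Measurable
        (Function.uncurry fun u a => g a * (truncPow α (u - a) * truncPow β (x - u))) :=
      (hg.measurable.comp measurable_snd).mul
        (((measurable_truncPow α).comp (measurable_fst.sub measurable_snd)).mul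
          ((measurable_truncPow β).comp (measurable_const.sub measurable_fst)))
    rw [integrable_prod_iff' hm.aestronglyMeasurable]
    constructor
    · filter_upwards [ae_restrict_mem measurableSet_Ioi] with a ha
      exact (hu a ha).1.const_mul (g a)
    · refine (((integrableOn_mul_truncPow (add_pos hα hβ) hg hx).norm).mul_const
        (beta α β)).congr ?_
      filter_upwards [ae_restrict_mem measurableSet_Ioi] with a ha
      have hn : ∀ u, ‖Function.uncurry (fun u a => g a * (truncPow α (u - a) * truncPow β (x - u)))
          (u, a)‖ = ‖g a‖ * (truncPow α (u - a) * truncPow β (x - u)) := fun u => by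
        simp only [Function.uncurry_apply_pair, norm_mul, Real.norm_of_nonneg (truncPow_nonneg _ _)]
      simp_rw [hn]
      rw [integral_const_mul, (hu a ha).2, norm_mul, Real.norm_of_nonneg (truncPow_nonneg _ _),
        mul_assoc]
  have hswap := integral_integral_swap hF
  have hL : ∫ u in Ioi (0 : ℝ), ∫ a in Ioi (0 : ℝ),
      g a * (truncPow α (u - a) * truncPow β (x - u)) =
      Real.Gamma α * ∫ u in (0 : ℝ)..x, fracIntegral α g u * (x - u) ^ (β - 1) := by
    rw [← setIntegral_truncPow β _ hx, ← integral_const_mul]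
    refine setIntegral_congr_fun measurableSet_Ioi fun u hu => ?_
    have hΓ := (Real.Gamma_pos_of_pos hα).ne'
    simp only [← mul_assoc]
    rw [integral_mul_const, setIntegral_truncPow α g (mem_Ioi.1 hu).le, fracIntegral]
    field_simp
  have hR : ∫ a in Ioi (0 : ℝ), ∫ u in Ioi (0 : ℝ),
      g a * (truncPow α (u - a) * truncPow β (x - u)) =
      beta α β * ∫ a in (0 : ℝ)..x, g a * (x - a) ^ (α + β - 1) := by
    rw [← setIntegral_truncPow (α + β) _ hx, ← integral_const_mul]
    refine setIntegral_congr_fun measurableSet_Ioi fun a ha => ?_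
    rw [integral_const_mul, (hu a ha).2]
    ring
  rw [hL, hR, beta] at hswap
  have h1 := (Real.Gamma_pos_of_pos hα).ne'
  have h2 := (Real.Gamma_pos_of_pos hβ).ne'
  have h3 := (Real.Gamma_pos_of_pos (add_pos hα hβ)).ne'
  rw [fracIntegral.eq_def β, fracIntegral.eq_def (α + β)]
  field_simp at hswap ⊢
  linear_combination hswap

lemma fracIntegral_one (f : ℝ → ℝ) (x : ℝ) : fracIntegral 1 f x = ∫ a in (0 : ℝ)..x, f a := by
  simp [fracIntegral]

/-- A fractional integral of positive order of a continuous function is continuous on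
`[0, ∞)`. -/
lemma exists_continuous_eq_fracIntegral {α : ℝ} (hα : 0 < α) {g : ℝ → ℝ} (hg : Continuous g) :
    ∃ G : ℝ → ℝ, Continuous G ∧ ∀ x, 0 ≤ x → fracIntegral α g x = G x := by
  refine ⟨fun x => (1 / Real.Gamma α) * (x ^ α * ∫ t in (0 : ℝ)..1, g (x * t) * (1 - t) ^ (α - 1)),
    ?_, fun x hx => ?_⟩
  · refine continuous_const.mul ((Real.continuous_rpow_const hα.le).mul ?_)
    refine continuous_iff_continuousAt.2 fun x₀ => ?_
    obtain ⟨C, hC⟩ := (isCompact_Icc (a := -(|x₀| + 1)) (b := |x₀| + 1)).exists_bound_of_continuousOn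
      hg.continuousOn
    refine intervalIntegral.continuousAt_of_dominated_interval
      (bound := fun t => C * (1 - t) ^ (α - 1)) (.of_forall fun x => ?_) ?_
      ((intervalIntegrable_sub_rpow hα 1).const_mul C) (.of_forall fun t _ => ?_)
    · exact ((hg.comp (continuous_const.mul continuous_id)).measurable.mul
        ((measurable_const.sub measurable_id).pow_const _)).aestronglyMeasurable
    · filter_upwards [Metric.ball_mem_nhds x₀ one_pos] with x hx
      refine .of_forall fun t ht => ?_
      rw [uIoc_of_le zero_le_one] at ht
      have h1 : 0 ≤ (1 - t) ^ (α - 1) := Real.rpow_nonneg (sub_nonneg.2 ht.2) _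
      rw [norm_mul, Real.norm_of_nonneg h1]
      refine mul_le_mul_of_nonneg_right (hC _ (abs_le.1 ?_)) h1
      rw [Metric.mem_ball, Real.dist_eq] at hx
      have h2 : |x| ≤ |x₀| + 1 := by linarith [abs_sub_abs_le_abs_sub x x₀]
      rw [abs_mul, abs_of_pos ht.1]
      exact (mul_le_of_le_one_right (abs_nonneg x) ht.2).trans h2
    · exact ((hg.comp (continuous_id.mul continuous_const)).mul continuous_const).continuousAt
  · rcases hx.eq_or_lt with rfl | hx
    · simp [fracIntegral, Real.zero_rpow hα.ne']
    · have h := intervalIntegral.mul_integral_comp_mul_left (a := 0) (b := 1)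
        (f := fun a => g a * (x - a) ^ (α - 1)) x
      rw [mul_zero, mul_one] at h
      rw [fracIntegral, ← h]
      congr 1
      rw [← intervalIntegral.integral_const_mul, ← intervalIntegral.integral_const_mul]
      refine intervalIntegral.integral_congr fun t ht => ?_
      rw [uIcc_of_le zero_le_one] at ht
      have h1 : x - x * t = x * (1 - t) := by ring
      have h2 : x ^ α = x * x ^ (α - 1) := by
        rw [Real.rpow_sub_one hx.ne']
        field_simp
      simp only [h1, h2, Real.mul_rpow hx.le (sub_nonneg.2 ht.2)]
      ring

lemma fracIntegral_congr {α x : ℝ} {f g : ℝ → ℝ} (hx : 0 ≤ x) (h : EqOn f g (Ioo 0 x)) :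
    fracIntegral α f x = fracIntegral α g x := by
  simp only [fracIntegral, intervalIntegral.integral_of_le hx, integral_Ioc_eq_integral_Ioo]
  congr 1
  exact setIntegral_congr_fun measurableSet_Ioo fun a ha => by simp only [h ha]

lemma fracIntegral_const {α x : ℝ} (hα : 0 < α) (c : ℝ) :
    fracIntegral α (fun _ => c) x = c / Real.Gamma α * (x ^ α / α) := by
  have h := intervalIntegral.integral_comp_sub_left (a := 0) (b := x)
    (fun a : ℝ => a ^ (α - 1)) x
  rw [sub_self, sub_zero, integral_rpow (Or.inl (by linarith))] at h
  rw [fracIntegral, intervalIntegral.integral_const_mul, h, sub_add_cancel,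
    Real.zero_rpow hα.ne']
  ring

lemma fracIntegral_add {α x : ℝ} {f g : ℝ → ℝ}
    (hf : IntervalIntegrable (fun a => f a * (x - a) ^ (α - 1)) volume 0 x)
    (hg : IntervalIntegrable (fun a => g a * (x - a) ^ (α - 1)) volume 0 x) :
    fracIntegral α (fun a => f a + g a) x = fracIntegral α f x + fracIntegral α g x := by
  simp only [fracIntegral, add_mul]
  rw [intervalIntegral.integral_add hf hg, mul_add]

/-- Abel's inversion: the Caputo fractional derivative of order n of the
Riemann–Liouville fractional integral of order n of ψ is ψ. -/
theorem abel_inversion_fractional_derivative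
    (n T : ℝ) (hn0 : 0 < n) (hn1 : n < 1) (hT : 0 < T)
    (ψ ψ' : ℝ → ℝ)
    (hderiv : ∀ x ∈ Set.Icc (0 : ℝ) T, HasDerivAt ψ (ψ' x) x)
    (hcont : ContinuousOn ψ' (Set.Icc (0 : ℝ) T))
    (s : ℝ → ℝ)
    (hs : ∀ x ∈ Set.Icc (0 : ℝ) T,
      s x = (1 / Real.Gamma n) * ∫ a in (0 : ℝ)..x, ψ a * (x - a) ^ (n - 1)) :
    (∀ x ∈ Set.Ioo (0 : ℝ) T, DifferentiableAt ℝ s x) ∧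
    (∀ x ∈ Set.Ioc (0 : ℝ) T,
      (1 / Real.Gamma (1 - n)) * (∫ a in (0 : ℝ)..x, deriv s a * (x - a) ^ (-n)) = ψ x) := by
  obtain ⟨g, hg, hgψ⟩ : ∃ g : ℝ → ℝ, Continuous g ∧ EqOn g ψ' (Icc 0 T) :=
    ⟨IccExtend hT.le ((Icc 0 T).domRestrict ψ'), hcont.domRestrict.Icc_extend',
      fun x hx => IccExtend_of_mem hT.le _ hx⟩
  have hψ : ∀ x ∈ Icc 0 T, ψ x = ψ 0 + fracIntegral 1 g x := by
    intro x hx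
    have hsub : uIcc 0 x ⊆ Icc 0 T := by
      rw [uIcc_of_le hx.1]
      exact Icc_subset_Icc_right hx.2
    rw [fracIntegral_one, intervalIntegral.integral_eq_sub_of_hasDerivAt
      (f := ψ) (fun y hy => by rw [hgψ (hsub hy)]; exact hderiv y (hsub hy))
      (hg.intervalIntegrable _ _)]
    ring
  have hn1' : 0 < 1 - n := sub_pos.2 hn1
  have hΓ := (Real.Gamma_pos_of_pos hn0).ne'
  have hΓ' := (Real.Gamma_pos_of_pos hn1').ne'
  obtain ⟨G, hG, hGg⟩ := exists_continuous_eq_fracIntegral hn0 hg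
  have hI : ∀ {α : ℝ}, 0 < α → ∀ {f : ℝ → ℝ}, Continuous f → ∀ x,
      IntervalIntegrable (fun a => f a * (x - a) ^ (α - 1)) volume 0 x :=
    fun {_} hα {_} hf x => (intervalIntegrable_sub_rpow hα x).continuousOn_mul hf.continuousOn
  have hsG : ∀ x ∈ Icc 0 T,
      s x = ψ 0 / Real.Gamma n * (x ^ n / n) + ∫ a in (0 : ℝ)..x, G a := by
    intro x hx
    have hprim : Continuous (fracIntegral 1 g) := by
      simp only [funext (fracIntegral_one g)]
      exact intervalIntegral.continuous_primitive (fun a b => hg.intervalIntegrable a b) 0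
    calc s x = fracIntegral n ψ x := hs x hx
      _ = fracIntegral n (fun a => ψ 0 + fracIntegral 1 g a) x :=
        fracIntegral_congr hx.1 fun a ha => hψ a ⟨ha.1.le, ha.2.le.trans hx.2⟩
      _ = ψ 0 / Real.Gamma n * (x ^ n / n) + fracIntegral 1 (fracIntegral n g) x := by
        rw [fracIntegral_add (hI hn0 continuous_const x) (hI hn0 hprim x), fracIntegral_const hn0,
          fracIntegral_fracIntegral one_pos hn0 hg hx.1,
          fracIntegral_fracIntegral hn0 one_pos hg hx.1, add_comm 1 n]
      _ = _ := by
        rw [fracIntegral_congr hx.1 fun a ha => hGg a ha.1.le, fracIntegral_one]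
  have hds : ∀ x ∈ Ioo 0 T, HasDerivAt s (ψ 0 / Real.Gamma n * x ^ (n - 1) + G x) x := by
    intro x hx
    have h1 : HasDerivAt (fun x : ℝ => ψ 0 / Real.Gamma n * (x ^ n / n))
        (ψ 0 / Real.Gamma n * x ^ (n - 1)) x := by
      have h := ((Real.hasDerivAt_rpow_const (p := n) (Or.inl hx.1.ne')).div_const n).const_mul
        (ψ 0 / Real.Gamma n)
      rwa [mul_div_cancel_left₀ _ hn0.ne'] at h
    refine (h1.add (hG.integral_hasStrictDerivAt 0 x).hasDerivAt).congr_of_eventuallyEq ?_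
    filter_upwards [Ioo_mem_nhds hx.1 hx.2] with y hy
    exact hsG y (Ioo_subset_Icc_self hy)
  refine ⟨fun x hx => (hds x hx).differentiableAt, fun x hx => ?_⟩
  have hpow : IntervalIntegrable
      (fun a => ψ 0 / Real.Gamma n * a ^ (n - 1) * (x - a) ^ (1 - n - 1)) volume 0 x := by
    simpa only [mul_assoc] using
      (intervalIntegrable_rpow_mul_sub_rpow hn0 hn1' hx.1).const_mul (ψ 0 / Real.Gamma n)
  calc (1 / Real.Gamma (1 - n)) * (∫ a in (0 : ℝ)..x, deriv s a * (x - a) ^ (-n))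
      = fracIntegral (1 - n) (deriv s) x := by
        rw [fracIntegral, show 1 - n - 1 = -n by ring]
    _ = fracIntegral (1 - n) (fun a => ψ 0 / Real.Gamma n * a ^ (n - 1) + G a) x :=
        fracIntegral_congr hx.1.le fun a ha => (hds a ⟨ha.1, ha.2.trans_le hx.2⟩).deriv
    _ = ψ 0 + fracIntegral (1 - n) (fracIntegral n g) x := by
        rw [fracIntegral_add hpow (hI hn1' hG x),
          fracIntegral_congr (g := fracIntegral n g) hx.1.le fun a ha => (hGg a ha.1.le).symm]
        congr 1
        simp only [fracIntegral, mul_assoc]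
        rw [intervalIntegral.integral_const_mul, integral_rpow_mul_sub_rpow hn0 hn1' hx.1, beta,
          add_sub_cancel, sub_self, Real.rpow_zero, Real.Gamma_one]
        field_simp
    _ = ψ x := by
        rw [fracIntegral_fracIntegral hn0 hn1' hg hx.1.le, add_sub_cancel,
          ← hψ x ⟨hx.1.le, hx.2⟩]
end

section
/- Let α > 0, 0 < n < 1, and x > 0. Then ∫_{a=0}^{x} (x − a)^{n−1} · ( ∫_{z=0}^{a} z^{α−1}·(a − z)^{−n} dz ) da = Γ(n)·Γ(1 − n)·x^{α}/α, where Γ is the real Gamma function. (The key double-integral evaluation in Abel's 1826 paper.) -/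
/-- The Beta integral on `[0, a]`, as a quotient of real Gamma functions. -/
theorem integral_rpow_mul_sub_rpow_s7 {s t a : ℝ} (hs : 0 < s) (ht : 0 < t) (ha : 0 < a) :
    (∫ z in (0 : ℝ)..a, z ^ (s - 1) * (a - z) ^ (t - 1))
      = a ^ (s + t - 1) * (Real.Gamma s * Real.Gamma t / Real.Gamma (s + t)) := by
  have h := Complex.betaIntegral_scaled (s : ℂ) (t : ℂ) ha
  rw [Complex.betaIntegral_eq_Gamma_mul_div _ _ (by simpa using hs) (by simpa using ht)] at h
  apply Complex.ofReal_injective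
  rw [← intervalIntegral.integral_ofReal]
  have hcongr : (∫ z in (0 : ℝ)..a, ((z ^ (s - 1) * (a - z) ^ (t - 1) : ℝ) : ℂ))
      = ∫ z in (0 : ℝ)..a, (z : ℂ) ^ ((s : ℂ) - 1) * ((a : ℂ) - z) ^ ((t : ℂ) - 1) := by
    refine intervalIntegral.integral_congr fun z hz => ?_
    rw [Set.uIcc_of_le ha.le] at hz
    have hz0 : 0 ≤ z := hz.1
    have hza : 0 ≤ a - z := sub_nonneg.2 hz.2
    simp [Complex.ofReal_cpow hz0, Complex.ofReal_cpow hza]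
  rw [hcongr, h]
  simp [Complex.ofReal_cpow ha.le, ← Complex.Gamma_ofReal]

/-- The key double-integral evaluation in Abel's 1826 paper:
∫_{0}^{x} (x − a)^{n−1}·( ∫_{0}^{a} z^{α−1}·(a − z)^{−n} dz ) da = Γ(n)·Γ(1 − n)·x^α/α. -/
theorem abel_double_integral_1826
    (α n x : ℝ) (hα : 0 < α) (hn0 : 0 < n) (hn1 : n < 1) (hx : 0 < x) :
    (∫ a in (0 : ℝ)..x, (x - a) ^ (n - 1) *
        ∫ z in (0 : ℝ)..a, z ^ (α - 1) * (a - z) ^ (-n))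
      = Real.Gamma n * Real.Gamma (1 - n) * x ^ α / α := by
  have hinner : (∫ a in (0 : ℝ)..x, (x - a) ^ (n - 1) *
        ∫ z in (0 : ℝ)..a, z ^ (α - 1) * (a - z) ^ (-n))
      = ∫ a in (0 : ℝ)..x, (Real.Gamma α * Real.Gamma (1 - n) / Real.Gamma (α + (1 - n))) *
        (a ^ (α + (1 - n) - 1) * (x - a) ^ (n - 1)) := by
    refine intervalIntegral.integral_congr_ae (Filter.Eventually.of_forall fun a ha => ?_)
    rw [Set.uIoc_of_le hx.le] at ha
    have h := integral_rpow_mul_sub_rpow_s7 hα (sub_pos.2 hn1) ha.1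
    rw [show 1 - n - 1 = -n by ring] at h
    rw [h]
    ring
  have hs : 0 < α + (1 - n) := by linarith
  rw [hinner, intervalIntegral.integral_const_mul, integral_rpow_mul_sub_rpow_s7 hs hn0 hx,
    show α + (1 - n) + n = α + 1 by ring, Real.Gamma_add_one hα.ne', add_sub_cancel_right]
  have h₁ := (Real.Gamma_pos_of_pos hα).ne'
  have h₂ := (Real.Gamma_pos_of_pos hs).ne'
  field_simp
end

section
/- Let T > 0 and let s : ℝ → ℝ be continuously differentiable on [0, T] with s(0) = 0. Define ψ(a) = ∫_{x=0}^{a} s'(x)·(a − x)^{−1/2} dx for a ∈ (0, T]. Then for every x ∈ (0, T], s(x) = (1/π) · ∫_{a=0}^{x} ψ(a)·(x − a)^{−1/2} da. (The solution of the original tautochrone-type equation, the case n = 1/2 that Abel states explicitly in both papers.) -/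
section AbelKernel

open MeasureTheory Set

/-- `arcsin ((2a - t - x) / (x - t))` is an antiderivative of `(a - t)^(-1/2) (x - a)^(-1/2)`. -/
theorem hasDerivAt_arcsin_affine {t x a : ℝ} (ha : a ∈ Ioo t x) :
    HasDerivAt (fun a => Real.arcsin ((2 * a - t - x) / (x - t)))
      ((a - t) ^ (-(1 / 2) : ℝ) * (x - a) ^ (-(1 / 2) : ℝ)) a := by
  obtain ⟨h1, h2⟩ := ha
  have hd : 0 < x - t := by linarith
  have hp : 0 < (a - t) * (x - a) := mul_pos (by linarith) (by linarith)
  have hlin : HasDerivAt (fun a : ℝ => (2 * a - t - x) / (x - t)) (2 / (x - t)) a := by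
    simpa using ((((hasDerivAt_id a).const_mul 2).sub_const t).sub_const x).div_const (x - t)
  have hne₁ : (2 * a - t - x) / (x - t) ≠ -1 := by
    rw [Ne, div_eq_iff hd.ne']
    intro h
    linarith
  have hne₂ : (2 * a - t - x) / (x - t) ≠ 1 := by
    rw [Ne, div_eq_iff hd.ne']
    intro h
    linarith
  refine ((Real.hasDerivAt_arcsin hne₁ hne₂).comp a hlin).congr_deriv ?_
  have hsq : 1 - ((2 * a - t - x) / (x - t)) ^ 2 = (2 / (x - t)) ^ 2 * ((a - t) * (x - a)) := by
    field_simp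
    ring
  rw [hsq, Real.sqrt_mul (by positivity), Real.sqrt_sq (by positivity),
    ← Real.mul_rpow (by linarith) (by linarith), Real.rpow_neg hp.le, ← Real.sqrt_eq_rpow]
  have := Real.sqrt_pos.2 hp
  field_simp

theorem integrableOn_abel_kernel {t x : ℝ} :
    IntegrableOn (fun a => (a - t) ^ (-(1 / 2) : ℝ) * (x - a) ^ (-(1 / 2) : ℝ)) (Ioc t x) :=
  intervalIntegral.integrableOn_deriv_of_nonneg
    (g := fun a => Real.arcsin ((2 * a - t - x) / (x - t)))
    (Real.continuous_arcsin.comp (by fun_prop)).continuousOn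
    (fun _ ha => hasDerivAt_arcsin_affine ha)
    (fun a ha => mul_nonneg (Real.rpow_nonneg (by linarith [ha.1]) _)
      (Real.rpow_nonneg (by linarith [ha.2]) _))

theorem integral_abel_kernel {t x : ℝ} (h : t < x) :
    ∫ a in Ioc t x, (a - t) ^ (-(1 / 2) : ℝ) * (x - a) ^ (-(1 / 2) : ℝ) = Real.pi := by
  have hd : x - t ≠ 0 := by linarith
  rw [← intervalIntegral.integral_of_le h.le,
    intervalIntegral.integral_eq_sub_of_hasDerivAt_of_le h.le
      (f := fun a => Real.arcsin ((2 * a - t - x) / (x - t)))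
      (Real.continuous_arcsin.comp (by fun_prop)).continuousOn
      (fun _ ha => hasDerivAt_arcsin_affine ha)
      ((intervalIntegrable_iff_integrableOn_Ioc_of_le h.le).2 integrableOn_abel_kernel)]
  have e1 : (2 * x - t - x) / (x - t) = 1 := by rw [div_eq_iff hd]; ring
  have e2 : (2 * t - t - x) / (x - t) = -1 := by rw [div_eq_iff hd]; ring
  simp only [e1, e2, Real.arcsin_one, Real.arcsin_neg_one]
  ring

/-- Inversion of the Abel transform of order `1/2`, in terms of the transformed function `g`. -/
theorem integral_abel_transform {g : ℝ → ℝ} {x : ℝ} (hg : ContinuousOn g (Icc 0 x)) :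
    ∫ a in Ioc 0 x, (∫ t in Ioc 0 a, g t * (a - t) ^ (-(1 / 2) : ℝ)) * (x - a) ^ (-(1 / 2) : ℝ) =
      Real.pi * ∫ t in Ioc 0 x, g t := by
  let k : ℝ → ℝ → ℝ := fun t a => (a - t) ^ (-(1 / 2) : ℝ) * (x - a) ^ (-(1 / 2) : ℝ)
  let K : ℝ → ℝ → ℝ := fun t a => (Ioi t).indicator (k t) a
  have hset : ∀ t ∈ Ioc 0 x, Ioc 0 x ∩ Ioi t = Ioc t x := fun t ht => by
    rw [Ioc_inter_Ioi, sup_eq_right.2 ht.1.le]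
  have hK_int : ∀ t ∈ Ioc 0 x, IntegrableOn (K t) (Ioc 0 x) := fun t ht => by
    rw [IntegrableOn, integrable_indicator_iff measurableSet_Ioi, IntegrableOn,
      Measure.restrict_restrict measurableSet_Ioi, inter_comm, hset t ht]
    exact integrableOn_abel_kernel
  have hK_val : ∀ t ∈ Ioo 0 x, ∫ a in Ioc 0 x, K t a = Real.pi := fun t ht => by
    rw [setIntegral_indicator measurableSet_Ioi, hset t ⟨ht.1, ht.2.le⟩]
    exact integral_abel_kernel ht.2
  have hK_nonneg : ∀ t, ∀ a ∈ Ioc 0 x, 0 ≤ K t a := fun t a ha =>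
    indicator_apply_nonneg fun hta => mul_nonneg
      (Real.rpow_nonneg (sub_nonneg.2 (le_of_lt hta)) _) (Real.rpow_nonneg (sub_nonneg.2 ha.2) _)
  have hK_meas : Measurable (Function.uncurry K) := by
    have h : Function.uncurry K = {p : ℝ × ℝ | p.1 < p.2}.indicator
        (fun p => (p.2 - p.1) ^ (-(1 / 2) : ℝ) * (x - p.2) ^ (-(1 / 2) : ℝ)) := by
      ext ⟨t, a⟩
      simp [K, k, Function.uncurry, indicator]
    rw [h]
    exact Measurable.indicator (by fun_prop) (measurableSet_lt measurable_fst measurable_snd)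
  have hgi : IntegrableOn g (Ioc 0 x) := hg.integrableOn_Icc.mono_set Ioc_subset_Icc_self
  have hae : ∀ᵐ t ∂volume.restrict (Ioc 0 x), t ∈ Ioo 0 x := by
    rw [← restrict_Ioo_eq_restrict_Ioc]
    exact ae_restrict_mem measurableSet_Ioo
  have hint : Integrable (Function.uncurry fun t a => g t * K t a)
      ((volume.restrict (Ioc 0 x)).prod (volume.restrict (Ioc 0 x))) := by
    refine (integrable_prod_iff
      (hgi.aestronglyMeasurable.comp_fst.mul hK_meas.aestronglyMeasurable)).2 ⟨hae.mono fun t ht => (hK_int t (Ioo_subset_Ioc_self ht)).const_mul (g t),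
      (hgi.norm.mul_const Real.pi).congr (hae.mono fun t ht => ?_)⟩
    simp only [Pi.mul_apply, Function.uncurry, norm_mul]
    rw [integral_const_mul, ← hK_val t ht]
    congr 1
    exact setIntegral_congr_fun measurableSet_Ioc fun a ha =>
      (Real.norm_of_nonneg (hK_nonneg t a ha)).symm
  have hswap := integral_integral_swap hint
  have hleft : ∫ t in Ioc 0 x, ∫ a in Ioc 0 x, g t * K t a = Real.pi * ∫ t in Ioc 0 x, g t := by
    rw [← integral_const_mul]
    refine integral_congr_ae (hae.mono fun t ht => ?_)
    simp only [integral_const_mul, hK_val t ht, mul_comm]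
  rw [← hleft, hswap]
  refine setIntegral_congr_fun measurableSet_Ioc fun a ha => ?_
  have h : ∀ t, g t * K t a = (Iio a).indicator
      (fun t => g t * (a - t) ^ (-(1 / 2) : ℝ) * (x - a) ^ (-(1 / 2) : ℝ)) t := fun t => by
    simp only [K, k, indicator, mem_Ioi, mem_Iio]
    split_ifs <;> ring
  have hI : Ioc 0 x ∩ Iio a = Ioo 0 a := by
    ext t
    exact ⟨fun h => ⟨h.1.1, h.2⟩, fun h => ⟨⟨h.1, h.2.le.trans ha.2⟩, h.2⟩⟩
  simp only [h]
  rw [setIntegral_indicator measurableSet_Iio, hI, ← integral_Ioc_eq_integral_Ioo,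
    integral_mul_const]

end AbelKernel

/-- The solution of the original tautochrone-type equation (the case n = 1/2):
if ψ(a) = ∫_{0}^{a} s'(x)·(a − x)^{−1/2} dx then
s(x) = (1/π) · ∫_{0}^{x} ψ(a)·(x − a)^{−1/2} da. -/
theorem abel_tautochrone_half
    (T : ℝ) (hT : 0 < T)
    (s s' : ℝ → ℝ)
    (hderiv : ∀ x ∈ Set.Icc (0 : ℝ) T, HasDerivAt s (s' x) x)
    (hcont : ContinuousOn s' (Set.Icc (0 : ℝ) T))
    (hs0 : s 0 = 0)
    (ψ : ℝ → ℝ)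
    (hψ : ∀ a ∈ Set.Ioc (0 : ℝ) T,
      ψ a = ∫ x in (0 : ℝ)..a, s' x * (a - x) ^ (-(1 / 2) : ℝ)) :
    ∀ x ∈ Set.Ioc (0 : ℝ) T,
      s x = (1 / Real.pi) * ∫ a in (0 : ℝ)..x, ψ a * (x - a) ^ (-(1 / 2) : ℝ) := by
  intro x hx
  have hsub : Set.Icc 0 x ⊆ Set.Icc 0 T := Set.Icc_subset_Icc_right hx.2
  have hc : ContinuousOn s' (Set.Icc 0 x) := hcont.mono hsub
  have hftc : ∫ t in (0 : ℝ)..x, s' t = s x := by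
    rw [intervalIntegral.integral_eq_sub_of_hasDerivAt (f := s), hs0, sub_zero]
    · intro t ht
      rw [Set.uIcc_of_le hx.1.le] at ht
      exact hderiv t (hsub ht)
    · exact hc.intervalIntegrable_of_Icc hx.1.le
  have hψ_int : ∫ a in (0 : ℝ)..x, ψ a * (x - a) ^ (-(1 / 2) : ℝ) = Real.pi * s x := by
    rw [← hftc, intervalIntegral.integral_of_le hx.1.le, intervalIntegral.integral_of_le hx.1.le,
      ← integral_abel_transform hc]
    refine MeasureTheory.setIntegral_congr_fun measurableSet_Ioc fun a ha => ?_
    simp only [hψ a ⟨ha.1, ha.2.trans hx.2⟩, intervalIntegral.integral_of_le ha.1.le]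
  rw [hψ_int, one_div, inv_mul_cancel_left₀ Real.pi_ne_zero]
end

section
/- Let 0 < n < 1 and T > 0. Let s₁, s₂ : ℝ → ℝ be continuously differentiable on [0, T] with s₁(0) = s₂(0), and suppose that ∫_{x=0}^{a} s₁'(x)·(a − x)^{−n} dx = ∫_{x=0}^{a} s₂'(x)·(a − x)^{−n} dx for every a ∈ (0, T]. Then s₁(x) = s₂(x) for every x ∈ [0, T]. (Injectivity of the Abel integral operator: the given time function determines the curve uniquely.) -/
section AbelKernel

open MeasureTheory Set

theorem intervalIntegrable_abelBeta {n : ℝ} (hn0 : 0 < n) (hn1 : n < 1) :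
    IntervalIntegrable (fun u : ℝ => u ^ (-n) * (1 - u) ^ (n - 1)) volume 0 1 := by
  have h := (Complex.betaIntegral_convergent (u := ((1 - n : ℝ) : ℂ)) (v := (n : ℂ))
    (by simpa using hn1) (by simpa using hn0)).norm
  refine h.congr_uIoo fun u hu => ?_
  rw [uIoo_of_le zero_le_one] at hu
  have h1 : (1 : ℂ) - u = ((1 - u : ℝ) : ℂ) := by push_cast; rfl
  simp only [norm_mul, h1]
  rw [Complex.norm_cpow_eq_rpow_re_of_pos hu.1,
    Complex.norm_cpow_eq_rpow_re_of_pos (sub_pos.2 hu.2)]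
  simp

theorem integral_abelBeta_pos {n : ℝ} (hn0 : 0 < n) (hn1 : n < 1) :
    0 < ∫ u in (0 : ℝ)..1, u ^ (-n) * (1 - u) ^ (n - 1) :=
  intervalIntegral.intervalIntegral_pos_of_pos_on (intervalIntegrable_abelBeta hn0 hn1)
    (fun _ hu => mul_pos (Real.rpow_pos_of_pos hu.1 _)
      (Real.rpow_pos_of_pos (sub_pos.2 hu.2) _)) one_pos

theorem abelKernel_eqOn (n : ℝ) {x X : ℝ} (hx : x < X) :
    EqOn (fun a => (X - x)⁻¹ *
        ((a / (X - x) - x / (X - x)) ^ (-n) * (1 - (a / (X - x) - x / (X - x))) ^ (n - 1)))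
      (fun a => (a - x) ^ (-n) * (X - a) ^ (n - 1)) (uIoo x X) := by
  intro a ha
  rw [uIoo_of_le hx.le] at ha
  have hL : 0 < X - x := sub_pos.2 hx
  have h1 : a / (X - x) - x / (X - x) = (a - x) / (X - x) := by ring
  have h2 : 1 - (a - x) / (X - x) = (X - a) / (X - x) := by field_simp; ring
  simp only [h1, h2]
  rw [Real.div_rpow (sub_pos.2 ha.1).le hL.le, Real.div_rpow (sub_pos.2 ha.2).le hL.le,
    Real.rpow_neg hL.le, Real.rpow_sub_one hL.ne']
  have := Real.rpow_pos_of_pos hL n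
  field_simp

theorem intervalIntegrable_abelKernel {n : ℝ} (hn0 : 0 < n) (hn1 : n < 1) {x X : ℝ} (hx : x < X) :
    IntervalIntegrable (fun a => (a - x) ^ (-n) * (X - a) ^ (n - 1)) volume x X := by
  have hL : X - x ≠ 0 := (sub_pos.2 hx).ne'
  refine IntervalIntegrable.congr_uIoo ?_ (abelKernel_eqOn n hx)
  have h := ((intervalIntegrable_abelBeta hn0 hn1).comp_sub_right (x / (X - x))).comp_mul_left
    (c := (X - x)⁻¹)
  have e1 : (0 + x / (X - x)) / (X - x)⁻¹ = x := by field_simp; ring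
  have e2 : (1 + x / (X - x)) / (X - x)⁻¹ = X := by field_simp; ring
  rw [e1, e2] at h
  simpa only [div_eq_inv_mul] using h.const_mul (X - x)⁻¹

theorem integral_abelKernel_s12 (n : ℝ) {x X : ℝ} (hx : x < X) :
    ∫ a in x..X, (a - x) ^ (-n) * (X - a) ^ (n - 1) =
      ∫ u in (0 : ℝ)..1, u ^ (-n) * (1 - u) ^ (n - 1) := by
  have hL : X - x ≠ 0 := (sub_pos.2 hx).ne'
  rw [← intervalIntegral.integral_congr_uIoo (abelKernel_eqOn n hx),
    intervalIntegral.integral_const_mul,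
    intervalIntegral.integral_comp_div_sub (fun u : ℝ => u ^ (-n) * (1 - u) ^ (n - 1)) hL,
    ← sub_div, sub_self, ← sub_div, div_self hL, zero_div, smul_eq_mul, inv_mul_cancel_left₀ hL]

theorem integrable_abelKernel_prod {n : ℝ} (hn0 : 0 < n) (hn1 : n < 1) {X : ℝ} {f : ℝ → ℝ}
    (hf : ContinuousOn f (Icc 0 X)) :
    Integrable (Function.uncurry fun x a => (Ioi x).indicator
        (fun a => f x * ((a - x) ^ (-n) * (X - a) ^ (n - 1))) a)
      ((volume.restrict (Ioo 0 X)).prod (volume.restrict (Ioo 0 X))) := by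
  have hfi : IntegrableOn f (Ioo 0 X) :=
    (hf.integrableOn_compact isCompact_Icc).mono_set Ioo_subset_Icc_self
  have hset : ∀ x ∈ Ioo 0 X, Ioi x ∩ Ioo 0 X = Ioo x X := fun x hx => by
    rw [inter_comm, Ioo_inter_Ioi, max_eq_right hx.1.le]
  rw [integrable_prod_iff]
  · constructor
    · filter_upwards [ae_restrict_mem measurableSet_Ioo] with x hx
      simp only [Function.uncurry_apply_pair]
      rw [integrable_indicator_iff measurableSet_Ioi, IntegrableOn,
        Measure.restrict_restrict measurableSet_Ioi, hset x hx]
      exact ((intervalIntegrable_iff_integrableOn_Ioo_of_le hx.2.le).1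
        (intervalIntegrable_abelKernel hn0 hn1 hx.2)).const_mul _
    · refine (hfi.norm.mul_const (∫ u in (0 : ℝ)..1, u ^ (-n) * (1 - u) ^ (n - 1))).congr ?_
      filter_upwards [ae_restrict_mem measurableSet_Ioo] with x hx
      simp only [Function.uncurry_apply_pair, norm_indicator_eq_indicator_norm]
      rw [integral_indicator measurableSet_Ioi,
        Measure.restrict_restrict measurableSet_Ioi, hset x hx, ← integral_abelKernel_s12 n hx.2,
        intervalIntegral.integral_of_le hx.2.le, integral_Ioc_eq_integral_Ioo,
        ← integral_const_mul]
      refine setIntegral_congr_fun measurableSet_Ioo fun a ha => ?_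
      have h1 := Real.rpow_nonneg (sub_pos.2 ha.1).le (-n)
      have h2 := Real.rpow_nonneg (sub_pos.2 ha.2).le (n - 1)
      simp only [norm_mul, Real.norm_of_nonneg h1, Real.norm_of_nonneg h2]
  · have hm : AEStronglyMeasurable (fun p : ℝ × ℝ =>
        f p.1 * ((p.2 - p.1) ^ (-n) * (X - p.2) ^ (n - 1)))
        ((volume.restrict (Ioo 0 X)).prod (volume.restrict (Ioo 0 X))) := by
      refine hfi.aestronglyMeasurable.comp_fst.mul ?_
      exact (by fun_prop : Measurable fun p : ℝ × ℝ =>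
        (p.2 - p.1) ^ (-n) * (X - p.2) ^ (n - 1)).aestronglyMeasurable
    exact hm.indicator (s := {p : ℝ × ℝ | p.1 < p.2}) (measurableSet_lt measurable_fst measurable_snd)

/-- Composing the Abel operators of orders `n` and `1 - n` gives a multiple of integration. -/
theorem integral_abelTransform {n : ℝ} (hn0 : 0 < n) (hn1 : n < 1) {X : ℝ} (hX : 0 ≤ X) {f : ℝ → ℝ}
    (hf : ContinuousOn f (Icc 0 X)) :
    ∫ a in (0 : ℝ)..X, (∫ x in (0 : ℝ)..a, f x * (a - x) ^ (-n)) * (X - a) ^ (n - 1) =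
      (∫ x in (0 : ℝ)..X, f x) * ∫ u in (0 : ℝ)..1, u ^ (-n) * (1 - u) ^ (n - 1) := by
  have h := integral_integral_swap (integrable_abelKernel_prod hn0 hn1 hf)
  rw [intervalIntegral.integral_of_le hX, intervalIntegral.integral_of_le hX,
    integral_Ioc_eq_integral_Ioo, integral_Ioc_eq_integral_Ioo, ← integral_mul_const]
  refine Eq.trans (Eq.trans ?_ h.symm) ?_
  · refine setIntegral_congr_fun measurableSet_Ioo fun a ha => ?_
    have hset : Iio a ∩ Ioo 0 X = Ioo 0 a := by
      rw [inter_comm, Ioo_inter_Iio, min_eq_right ha.2.le]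
    have hind : (fun x => (Ioi x).indicator
        (fun a => f x * ((a - x) ^ (-n) * (X - a) ^ (n - 1))) a) =
        (Iio a).indicator fun x => f x * (a - x) ^ (-n) * (X - a) ^ (n - 1) := by
      ext x; simp only [indicator, mem_Ioi, mem_Iio, mul_assoc]
    simp only [hind]
    rw [integral_indicator measurableSet_Iio, Measure.restrict_restrict measurableSet_Iio, hset,
      integral_mul_const, intervalIntegral.integral_of_le ha.1.le, integral_Ioc_eq_integral_Ioo]
  · refine setIntegral_congr_fun measurableSet_Ioo fun x hx => ?_
    have hset : Ioi x ∩ Ioo 0 X = Ioo x X := by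
      rw [inter_comm, Ioo_inter_Ioi, max_eq_right hx.1.le]
    rw [integral_indicator measurableSet_Ioi, Measure.restrict_restrict measurableSet_Ioi, hset,
      integral_const_mul, ← integral_abelKernel_s12 n hx.2, intervalIntegral.integral_of_le hx.2.le,
      integral_Ioc_eq_integral_Ioo]

theorem intervalIntegrable_mul_sub_rpow_neg {n : ℝ} (hn1 : n < 1) {a : ℝ} (ha : 0 ≤ a) {f : ℝ → ℝ}
    (hf : ContinuousOn f (Icc 0 a)) :
    IntervalIntegrable (fun x => f x * (a - x) ^ (-n)) volume 0 a := by
  have h := ((intervalIntegral.intervalIntegrable_rpow' (r := -n) (by linarith)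
    (a := 0) (b := a)).comp_sub_left a).symm
  simp only [sub_self, sub_zero] at h
  exact h.continuousOn_mul (by rwa [uIcc_of_le ha])

end AbelKernel

/-- Injectivity of the Abel integral operator: the given time function determines
the curve uniquely. -/
theorem abel_operator_injective
    (n T : ℝ) (hn0 : 0 < n) (hn1 : n < 1) (hT : 0 < T)
    (s₁ s₁' s₂ s₂' : ℝ → ℝ)
    (hderiv₁ : ∀ x ∈ Set.Icc (0 : ℝ) T, HasDerivAt s₁ (s₁' x) x)
    (hcont₁ : ContinuousOn s₁' (Set.Icc (0 : ℝ) T))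
    (hderiv₂ : ∀ x ∈ Set.Icc (0 : ℝ) T, HasDerivAt s₂ (s₂' x) x)
    (hcont₂ : ContinuousOn s₂' (Set.Icc (0 : ℝ) T))
    (h0 : s₁ 0 = s₂ 0)
    (heq : ∀ a ∈ Set.Ioc (0 : ℝ) T,
      (∫ x in (0 : ℝ)..a, s₁' x * (a - x) ^ (-n))
        = ∫ x in (0 : ℝ)..a, s₂' x * (a - x) ^ (-n)) :
    ∀ x ∈ Set.Icc (0 : ℝ) T, s₁ x = s₂ x := by
  intro X hX
  have hf : ContinuousOn (fun x => s₁' x - s₂' x) (Set.Icc 0 T) := hcont₁.sub hcont₂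
  have hsub : ∀ {a}, a ≤ T → Set.Icc 0 a ⊆ Set.Icc 0 T := fun h => Set.Icc_subset_Icc_right h
  have hfX := hf.mono (hsub hX.2)
  have h := integral_abelTransform hn0 hn1 hX.1 hfX
  have hzero : ∫ a in (0 : ℝ)..X,
      (∫ x in (0 : ℝ)..a, (s₁' x - s₂' x) * (a - x) ^ (-n)) * (X - a) ^ (n - 1) = 0 := by
    refine (intervalIntegral.integral_congr_Ioo_of_le (g := fun _ => (0 : ℝ)) hX.1
      fun a ha => ?_).trans intervalIntegral.integral_zero
    have haT : a ≤ T := ha.2.le.trans hX.2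
    simp only [sub_mul]
    rw [intervalIntegral.integral_sub
      (intervalIntegrable_mul_sub_rpow_neg hn1 ha.1.le (hcont₁.mono (hsub haT)))
      (intervalIntegrable_mul_sub_rpow_neg hn1 ha.1.le (hcont₂.mono (hsub haT))),
      heq a ⟨ha.1, haT⟩, sub_self, zero_mul]
  rw [hzero] at h
  have hint := (mul_eq_zero.1 h.symm).resolve_right (integral_abelBeta_pos hn0 hn1).ne'
  rw [← Set.uIcc_of_le hX.1] at hfX
  rw [intervalIntegral.integral_eq_sub_of_hasDerivAt (f := fun x => s₁ x - s₂ x) (fun x hx => ?_)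
    hfX.intervalIntegrable] at hint
  · linarith
  · rw [Set.uIcc_of_le hX.1] at hx
    exact (hderiv₁ x (hsub hX.2 hx)).sub (hderiv₂ x (hsub hX.2 hx))
end

section
/- Let 0 < n < 1 and T > 0, and let ψ : ℝ → ℝ be continuously differentiable on [0, T]. Then for every x ∈ (0, T), the function u ↦ ∫_{a=0}^{u} ψ(a)·(u − a)^{n−1} da is differentiable at x with derivative ψ(0)·x^{n−1} + ∫_{a=0}^{x} ψ'(a)·(x − a)^{n−1} da. (The differentiation rule for the Riemann–Liouville fractional integral used implicitly in Abel's inversion of his equation.) -/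
theorem mul_rpow_sub_one {x : ℝ} (hx : x ≠ 0) (n : ℝ) : x * x ^ (n - 1) = x ^ n := by
  rw [Real.rpow_sub_one hx, mul_div_cancel₀ _ hx]

/-- The singular kernel of the fractional integral is integrable on the unit interval. -/
theorem intervalIntegrable_one_sub_rpow {n : ℝ} (hn0 : 0 < n) :
    IntervalIntegrable (fun s : ℝ => (1 - s) ^ (n - 1)) MeasureTheory.volume 0 1 := by
  have h := (intervalIntegral.intervalIntegrable_rpow' (a := 1) (b := 0)
    (r := n - 1) (by linarith)).comp_sub_left 1
  simpa using h

/-- Rescaling the fractional integral over `[0, u]` to the unit interval. -/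
theorem integral_mul_sub_rpow_eq_scaled (f : ℝ → ℝ) (n : ℝ) {u : ℝ} (hu : 0 < u) :
    ∫ a in (0 : ℝ)..u, f a * (u - a) ^ (n - 1) =
      u ^ n * ∫ s in (0 : ℝ)..1, f (u * s) * (1 - s) ^ (n - 1) := by
  have h := intervalIntegral.mul_integral_comp_mul_left (a := 0) (b := 1)
    (f := fun a => f a * (u - a) ^ (n - 1)) (c := u)
  simp only [mul_zero, mul_one] at h
  rw [← h, ← intervalIntegral.integral_const_mul, ← intervalIntegral.integral_const_mul]
  refine intervalIntegral.integral_congr fun s hs => ?_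
  rw [Set.uIcc_of_le zero_le_one] at hs
  have hfac : u - u * s = u * (1 - s) := by ring
  simp only [hfac, Real.mul_rpow hu.le (sub_nonneg.2 hs.2), ← mul_rpow_sub_one hu.ne' n]
  ring

/-- A function continuous on `[0, T]`, dilated by `u ∈ [0, T]`, is continuous on `[0, 1]`. -/
theorem ContinuousOn.comp_mul_left_unitInterval {f : ℝ → ℝ} {T u : ℝ}
    (hf : ContinuousOn f (Set.Icc 0 T)) (hu : u ∈ Set.Icc 0 T) :
    ContinuousOn (fun s => f (u * s)) (Set.Icc 0 1) := by
  refine hf.comp (by fun_prop) fun s hs => ⟨mul_nonneg hu.1 hs.1, ?_⟩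
  nlinarith [hu.1, hu.2, hs.1, hs.2]

/-- Integrability of a dilated continuous function against the singular kernel. -/
theorem intervalIntegrable_comp_mul_one_sub_rpow {f : ℝ → ℝ} {n T u : ℝ} (hn0 : 0 < n)
    (hf : ContinuousOn f (Set.Icc 0 T)) (hu : u ∈ Set.Icc 0 T) :
    IntervalIntegrable (fun s => f (u * s) * (1 - s) ^ (n - 1)) MeasureTheory.volume 0 1 := by
  refine (intervalIntegrable_one_sub_rpow hn0).continuousOn_mul ?_
  rw [Set.uIcc_of_le zero_le_one]
  exact hf.comp_mul_left_unitInterval hu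

open MeasureTheory Set in
/-- Differentiation under the integral sign for the rescaled fractional integral. -/
theorem hasDerivAt_integral_comp_mul_one_sub_rpow {n T : ℝ} (hn0 : 0 < n) {ψ ψ' : ℝ → ℝ}
    (hderiv : ∀ a ∈ Icc (0 : ℝ) T, HasDerivAt ψ (ψ' a) a)
    (hcont : ContinuousOn ψ' (Icc (0 : ℝ) T)) {x : ℝ} (hx : x ∈ Ioo (0 : ℝ) T) :
    HasDerivAt (fun u => ∫ s in (0 : ℝ)..1, ψ (u * s) * (1 - s) ^ (n - 1))
      (∫ s in (0 : ℝ)..1, s * (ψ' (x * s) * (1 - s) ^ (n - 1))) x := by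
  have hψ : ContinuousOn ψ (Icc 0 T) := fun a ha => (hderiv a ha).continuousAt.continuousWithinAt
  obtain ⟨M, hM⟩ := isCompact_Icc.exists_bound_of_continuousOn hcont
  have hnhds : Ioo (0 : ℝ) T ∈ nhds x := Ioo_mem_nhds hx.1 hx.2
  refine (intervalIntegral.hasDerivAt_integral_of_dominated_loc_of_deriv_le
    (F := fun u s => ψ (u * s) * (1 - s) ^ (n - 1))
    (F' := fun u s => s * (ψ' (u * s) * (1 - s) ^ (n - 1)))
    (bound := fun s => M * (1 - s) ^ (n - 1)) hnhds ?_ ?_ ?_ ?_ ?_ ?_).2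
  · filter_upwards [hnhds] with u hu
    exact (intervalIntegrable_comp_mul_one_sub_rpow hn0 hψ
      (Ioo_subset_Icc_self hu)).def'.aestronglyMeasurable
  · exact intervalIntegrable_comp_mul_one_sub_rpow hn0 hψ (Ioo_subset_Icc_self hx)
  · exact ((intervalIntegrable_comp_mul_one_sub_rpow hn0 hcont
      (Ioo_subset_Icc_self hx)).continuousOn_mul continuousOn_id).def'.aestronglyMeasurable
  · refine Filter.Eventually.of_forall fun s hs u hu => ?_
    rw [uIoc_of_le zero_le_one] at hs
    have hmem : u * s ∈ Icc 0 T :=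
      ⟨mul_nonneg hu.1.le hs.1.le, by nlinarith [hu.1, hu.2, hs.1, hs.2]⟩
    have hk : 0 ≤ (1 - s) ^ (n - 1) := Real.rpow_nonneg (sub_nonneg.2 hs.2) _
    rw [norm_mul, norm_mul, Real.norm_of_nonneg hs.1.le, Real.norm_of_nonneg hk]
    have hb := mul_le_mul_of_nonneg_right (hM _ hmem) hk
    exact (mul_le_of_le_one_left (by positivity) hs.2).trans hb
  · exact (intervalIntegrable_one_sub_rpow hn0).const_mul M
  · refine Filter.Eventually.of_forall fun s hs u hu => ?_
    rw [uIoc_of_le zero_le_one] at hs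
    have hmem : u * s ∈ Icc 0 T :=
      ⟨mul_nonneg hu.1.le hs.1.le, by nlinarith [hu.1, hu.2, hs.1, hs.2]⟩
    have h := ((hderiv _ hmem).comp u (hasDerivAt_mul_const s)).mul_const ((1 - s) ^ (n - 1))
    exact h.congr_deriv (by ring)

open MeasureTheory Set in
/-- Integration by parts for the rescaled fractional integral. -/
theorem mul_integral_comp_mul_one_sub_rpow {n T : ℝ} (hn0 : 0 < n) {ψ ψ' : ℝ → ℝ}
    (hderiv : ∀ a ∈ Icc (0 : ℝ) T, HasDerivAt ψ (ψ' a) a)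
    (hcont : ContinuousOn ψ' (Icc (0 : ℝ) T)) {x : ℝ} (hx : x ∈ Icc (0 : ℝ) T) :
    n * ∫ s in (0 : ℝ)..1, ψ (x * s) * (1 - s) ^ (n - 1) =
      ψ 0 + x * ((∫ s in (0 : ℝ)..1, ψ' (x * s) * (1 - s) ^ (n - 1)) -
        ∫ s in (0 : ℝ)..1, s * (ψ' (x * s) * (1 - s) ^ (n - 1))) := by
  have hψ : ContinuousOn ψ (Icc 0 T) := fun a ha => (hderiv a ha).continuousAt.continuousWithinAt
  have hI := intervalIntegrable_comp_mul_one_sub_rpow hn0 hψ hx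
  have hI' := intervalIntegrable_comp_mul_one_sub_rpow hn0 hcont hx
  have hsI' : IntervalIntegrable (fun s => s * (ψ' (x * s) * (1 - s) ^ (n - 1))) volume 0 1 :=
    hI'.continuousOn_mul continuousOn_id
  have hftc := intervalIntegral.integral_eq_sub_of_hasDerivAt_of_le zero_le_one
    (f := fun s => ψ (x * s) * (1 - s) ^ n)
    (f' := fun s => x * (ψ' (x * s) * (1 - s) ^ (n - 1) - s * (ψ' (x * s) * (1 - s) ^ (n - 1)))
      - n * (ψ (x * s) * (1 - s) ^ (n - 1))) ?_ ?_ ?_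
  · rw [intervalIntegral.integral_sub ((hI'.sub hsI').const_mul x) (hI.const_mul n),
      intervalIntegral.integral_const_mul, intervalIntegral.integral_const_mul,
      intervalIntegral.integral_sub hI' hsI'] at hftc
    simp only [sub_self, Real.zero_rpow hn0.ne', mul_zero, sub_zero, Real.one_rpow, mul_one]
      at hftc
    linarith
  · refine (hψ.comp_mul_left_unitInterval hx).mul (Continuous.continuousOn ?_)
    exact (continuous_const.sub continuous_id).rpow_const fun _ => Or.inr hn0.le
  · intro s hs
    have hmem : x * s ∈ Icc 0 T :=
      ⟨mul_nonneg hx.1 hs.1.le, by nlinarith [hx.1, hx.2, hs.1, hs.2]⟩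
    have hpos : 0 < 1 - s := sub_pos.2 hs.2
    have hk := ((hasDerivAt_id s).const_sub 1).rpow_const (p := n) (Or.inl hpos.ne')
    have h := ((hderiv _ hmem).comp s (hasDerivAt_const_mul x)).mul hk
    refine h.congr_deriv ?_
    simp only [id, Function.comp_apply, ← mul_rpow_sub_one hpos.ne' n]
    ring
  · exact ((hI'.sub hsI').const_mul x).sub (hI.const_mul n)

/-- The differentiation rule for the Riemann–Liouville fractional integral used
implicitly in Abel's inversion of his equation. -/
theorem abel_RL_integral_derivative
    (n T : ℝ) (hn0 : 0 < n) (hn1 : n < 1) (hT : 0 < T)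
    (ψ ψ' : ℝ → ℝ)
    (hderiv : ∀ a ∈ Set.Icc (0 : ℝ) T, HasDerivAt ψ (ψ' a) a)
    (hcont : ContinuousOn ψ' (Set.Icc (0 : ℝ) T)) :
    ∀ x ∈ Set.Ioo (0 : ℝ) T,
      HasDerivAt (fun u => ∫ a in (0 : ℝ)..u, ψ a * (u - a) ^ (n - 1))
        (ψ 0 * x ^ (n - 1) + ∫ a in (0 : ℝ)..x, ψ' a * (x - a) ^ (n - 1)) x := by
  intro x hx
  have hpow := Real.hasDerivAt_rpow_const (p := n) (Or.inl hx.1.ne')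
  have h := hpow.mul (hasDerivAt_integral_comp_mul_one_sub_rpow hn0 hderiv hcont hx)
  refine (h.congr_of_eventuallyEq ?_).congr_deriv ?_
  · filter_upwards [Ioi_mem_nhds hx.1] with u hu
    exact integral_mul_sub_rpow_eq_scaled ψ n hu
  · have hparts := mul_integral_comp_mul_one_sub_rpow hn0 hderiv hcont
      (Set.Ioo_subset_Icc_self hx)
    rw [integral_mul_sub_rpow_eq_scaled ψ' n hx.1, ← mul_rpow_sub_one hx.1.ne' n]
    linear_combination x ^ (n - 1) * hparts
end
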